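/- arXiv:2301.12681 — 9 statements merged into one kernel-verified Lean document; each statement's English description precedes it below -/
import Mathlib

section
/- Let R be an integral domain and n ≥ 0. If A is an R-subalgebra of the Laurent polynomial ring R[x₁^{±1}, …, xₙ^{±1}] and A is an R-retract of R[x₁^{±1}, …, xₙ^{±1}] (i.e., there is an R-algebra homomorphism φ : R[x₁^{±1}, …, xₙ^{±1}] → A restricting to the identity on A), then A is R-algebra isomorphic to a Laurent polynomial ring R[y₁^{±1}, …, y_r^{±1}] for some 0 ≤ r ≤ n. -/
/-- The Laurent polynomial ring `R[x₁^{±1}, …, xₙ^{±1}]`, realized as the monoid algebra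
of `ℤⁿ` over `R`. -/
abbrev LaurentRing (R : Type*) [CommRing R] (n : ℕ) : Type _ :=
  AddMonoidAlgebra R (Fin n → ℤ)

/-- Over a domain, every unit of an additive monoid algebra whose exponents have two unique sums
is a monomial with nonzero coefficient. -/
theorem AddMonoidAlgebra.exists_eq_single_of_isUnit {R G : Type*} [CommRing R] [IsDomain R]
    [AddCommMonoid G] [TwoUniqueSums G] {f : AddMonoidAlgebra R G} (hf : IsUnit f) :
    ∃ (m : G) (c : R), IsUnit c ∧ f = AddMonoidAlgebra.single m c := by
  classical
  obtain ⟨g, hg⟩ := hf.exists_right_inv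
  have hf0 : f.coeff ≠ 0 := by
    intro h
    have : f = 0 := AddMonoidAlgebra.coeff_injective h
    simp [this] at hg
  have hg0 : g.coeff ≠ 0 := by
    intro h
    have : g = 0 := AddMonoidAlgebra.coeff_injective h
    simp [this] at hg
  have hcf : 0 < f.coeff.support.card := Finset.card_pos.2 (Finsupp.support_nonempty_iff.2 hf0)
  have hcg : 0 < g.coeff.support.card := Finset.card_pos.2 (Finsupp.support_nonempty_iff.2 hg0)
  have hzero : ∀ p ∈ f.coeff.support ×ˢ g.coeff.support,
      UniqueAdd f.coeff.support g.coeff.support p.1 p.2 → p.1 + p.2 = 0 := by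
    intro p hp hu
    by_contra hne
    have h := AddMonoidAlgebra.coeff_mul_add_of_uniqueAdd hu
    rw [hg, AddMonoidAlgebra.one_def, AddMonoidAlgebra.coeff_single,
      Finsupp.single_eq_of_ne hne] at h
    rw [Finset.mem_product, Finsupp.mem_support_iff, Finsupp.mem_support_iff] at hp
    exact mul_ne_zero hp.1 hp.2 h.symm
  have hcard : f.coeff.support.card * g.coeff.support.card ≤ 1 := by
    by_contra! hlt
    obtain ⟨p, hp, q, hq, hpq, hup, huq⟩ := TwoUniqueSums.uniqueAdd_of_one_lt_card hlt
    have hq' := Finset.mem_product.1 hq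
    obtain ⟨h₁, h₂⟩ := hup hq'.1 hq'.2 ((hzero q hq huq).trans (hzero p hp hup).symm)
    exact hpq (Prod.ext h₁.symm h₂.symm)
  have hf1 : f.coeff.support.card = 1 := by nlinarith
  have hg1 : g.coeff.support.card = 1 := by nlinarith
  obtain ⟨a, c, -, hac⟩ := Finsupp.card_support_eq_one'.1 hf1
  obtain ⟨b, d, -, hbd⟩ := Finsupp.card_support_eq_one'.1 hg1
  have hfa : f = AddMonoidAlgebra.single a c := AddMonoidAlgebra.coeff_injective hac
  have hgb : g = AddMonoidAlgebra.single b d := AddMonoidAlgebra.coeff_injective hbd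
  refine ⟨a, c, ?_, hfa⟩
  rw [hfa, hgb, AddMonoidAlgebra.single_mul_single, AddMonoidAlgebra.one_def,
    AddMonoidAlgebra.single_inj] at hg
  rcases hg with h | h
  · exact IsUnit.of_mul_eq_one _ h.2
  · exact absurd h.2 one_ne_zero

/-- An algebra homomorphism between group algebras over a domain sends monomials to
monomials, and the induced map on exponents is additive. -/
theorem AddMonoidAlgebra.exists_addMonoidHom_map_single {R G H : Type*} [CommRing R] [IsDomain R]
    [AddCommGroup G] [AddCommGroup H] [TwoUniqueSums H]
    (ψ : AddMonoidAlgebra R G →ₐ[R] AddMonoidAlgebra R H) :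
    ∃ (M : G →+ H) (u : G → R), (∀ a, IsUnit (u a)) ∧
      ∀ a, ψ (AddMonoidAlgebra.single a 1) = AddMonoidAlgebra.single (M a) (u a) := by
  have hunit : ∀ a : G, IsUnit (ψ (AddMonoidAlgebra.single a 1)) := fun a ↦
    IsUnit.map ψ <| IsUnit.of_mul_eq_one (AddMonoidAlgebra.single (-a) 1) <| by
      simp [AddMonoidAlgebra.single_mul_single, AddMonoidAlgebra.one_def]
  choose M u hu hM using fun a ↦ AddMonoidAlgebra.exists_eq_single_of_isUnit (hunit a)
  refine ⟨AddMonoidHom.mk' M fun a b ↦ ?_, u, hu, hM⟩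
  have h : AddMonoidAlgebra.single (M (a + b)) (u (a + b)) =
      AddMonoidAlgebra.single (M a + M b) (u a * u b) := by
    rw [← AddMonoidAlgebra.single_mul_single, ← hM, ← hM, ← hM, ← map_mul,
      AddMonoidAlgebra.single_mul_single, mul_one]
  rcases AddMonoidAlgebra.single_inj.1 h with h | h
  · exact h.1
  · exact absurd h.1 (hu _).ne_zero

/-- A subgroup of `ℤⁿ` given as the range of an additive map from `ℤⁿ` is the image of an injective
map from `ℤʳ` with `r ≤ n`. -/
theorem AddMonoidHom.exists_injective_range_eq {n : ℕ} (M : (Fin n → ℤ) →+ (Fin n → ℤ)) :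
    ∃ (r : ℕ) (j : (Fin r → ℤ) →+ (Fin n → ℤ)),
      r ≤ n ∧ Function.Injective j ∧ Set.range j = Set.range M := by
  let N : Submodule ℤ (Fin n → ℤ) := M.toIntLinearMap.range
  let e := (Module.finBasis ℤ N).equivFun
  refine ⟨Module.finrank ℤ N, (N.subtype ∘ₗ e.symm.toLinearMap).toAddMonoidHom, ?_, ?_, ?_⟩
  · simpa using Submodule.finrank_le N
  · exact N.injective_subtype.comp e.symm.injective
  · change Set.range (Subtype.val ∘ e.symm) = Set.range M
    rw [e.symm.surjective.range_comp, Subtype.range_coe]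
    rfl

/-- **Retracts of Laurent polynomial rings.**  Let `R` be an integral domain and `n ≥ 0`.
Every `R`-subalgebra `A` of `R[x₁^{±1}, …, xₙ^{±1}]` which is an `R`-retract is `R`-algebra
isomorphic to a Laurent polynomial ring `R[y₁^{±1}, …, y_r^{±1}]` for some `0 ≤ r ≤ n`. -/
theorem retract_of_laurent_isLaurent (R : Type*) [CommRing R] [IsDomain R] (n : ℕ)
    (A : Subalgebra R (LaurentRing R n))
    (φ : LaurentRing R n →ₐ[R] A)
    (hφ : ∀ a : A, φ (a : LaurentRing R n) = a) :
    ∃ r : ℕ, r ≤ n ∧ Nonempty (A ≃ₐ[R] LaurentRing R r) := by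
  obtain ⟨M, u, hu, hM⟩ := AddMonoidAlgebra.exists_addMonoidHom_map_single (A.val.comp φ)
  obtain ⟨r, j, hr, hj, hjM⟩ := M.exists_injective_range_eq
  let J : LaurentRing R r →ₐ[R] LaurentRing R n := AddMonoidAlgebra.mapDomainAlgHom R R j
  have hJ : Function.Injective J := AddMonoidAlgebra.mapDomain_injective hj
  have hJs : ∀ b c, J (AddMonoidAlgebra.single b c) = AddMonoidAlgebra.single (j b) c :=
    fun b c ↦ AddMonoidAlgebra.mapDomain_single
  have hsmul : ∀ {G : Type} (a : G) (c : R), AddMonoidAlgebra.single a c =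
      c • AddMonoidAlgebra.single a (1 : R) := fun a c ↦ by simp
  have hrange : J.range = A := by
    apply le_antisymm
    · rintro _ ⟨f, rfl⟩
      change J f ∈ A
      induction f using AddMonoidAlgebra.induction_linear with
      | zero => simp
      | add f g hf hg => rw [map_add]; exact A.add_mem hf hg
      | single b c =>
        obtain ⟨a, ha⟩ : j b ∈ Set.range M := hjM ▸ Set.mem_range_self b
        obtain ⟨v, hv⟩ := (hu a).exists_left_inv
        have h : AddMonoidAlgebra.single (j b) c =
            (c * v) • ((A.val.comp φ) (AddMonoidAlgebra.single a 1)) := by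
          rw [hM, ha, AddMonoidAlgebra.smul_single, smul_eq_mul, mul_assoc, hv, mul_one]
        rw [hJs, h]
        exact A.smul_mem (φ _).2 _
    · have hmem : ∀ f, (A.val.comp φ) f ∈ J.range := by
        intro f
        induction f using AddMonoidAlgebra.induction_linear with
        | zero => simp
        | add f g hf hg => rw [map_add]; exact J.range.add_mem hf hg
        | single a c =>
          obtain ⟨b, hb⟩ : M a ∈ Set.range j := hjM ▸ Set.mem_range_self a
          rw [hsmul, map_smul, hM, ← hb, ← hJs]
          exact J.range.smul_mem ⟨_, rfl⟩ _
      intro a ha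
      have h := hmem a
      rwa [AlgHom.comp_apply, hφ ⟨a, ha⟩] at h
  exact ⟨r, hr, ⟨((AlgEquiv.ofInjective J hJ).trans (Subalgebra.equivOfEq _ _ hrange)).symm⟩⟩
end

section
/- Let R be a commutative ring, B an integral domain which is an R-algebra, and A ⊆ B an R-subalgebra which is an R-retract of B. Then A is algebraically closed in B: every element b ∈ B which is a root of some nonzero polynomial with coefficients in A belongs to A. -/
/-- **Retracts are algebraically closed** (Costa).  Let `R` be a commutative ring, `B` an
integral domain which is an `R`-algebra and `A ⊆ B` an `R`-subalgebra which is an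
`R`-retract of `B`.  Then every element of `B` which is a root of a nonzero polynomial with
coefficients in `A` belongs to `A`. -/
theorem retract_algebraically_closed (R B : Type*) [CommRing R] [CommRing B] [IsDomain B]
    [Algebra R B] (A : Subalgebra R B)
    (φ : B →ₐ[R] A) (hφ : ∀ a : A, φ (a : B) = a)
    (b : B) (p : Polynomial A) (hp : p ≠ 0) (hroot : Polynomial.aeval b p = 0) :
    b ∈ A := by
  have halg : IsAlgebraic A (b - algebraMap A B (φ b)) :=
    IsAlgebraic.sub ⟨p, hp, hroot⟩ (isAlgebraic_algebraMap _)
  by_contra hb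
  have ht : b - algebraMap A B (φ b) ≠ 0 := fun h =>
    hb (sub_eq_zero.mp h ▸ (φ b).2)
  obtain ⟨q, hq0, hq⟩ := halg.exists_nonzero_coeff_and_aeval_eq_zero
    (mem_nonZeroDivisors_of_ne_zero ht)
  have hφA : (φ : B →+* A).comp (algebraMap A B) = RingHom.id A := RingHom.ext hφ
  have hφt : (φ : B →+* A) (b - algebraMap A B (φ b)) = 0 := by
    rw [map_sub, sub_eq_zero]
    exact (hφ (φ b)).symm
  have h := congrArg (φ : B →+* A) hq
  rw [Polynomial.aeval_def, Polynomial.hom_eval₂, hφA, hφt, map_zero] at h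
  exact hq0 (by rw [Polynomial.coeff_zero_eq_eval_zero]; exact h)
end

section
/- Let R be a unique factorization domain and let A be an R-subalgebra of the polynomial ring R[x₁, x₂] which is an R-retract of R[x₁, x₂]. Then A is R-algebra isomorphic to a polynomial ring R^{[s]} in s variables over R for some s ∈ {0, 1, 2}. -/
/-- A retract of a unique factorization domain is a unique factorization domain. -/
theorem UniqueFactorizationMonoid.of_leftInverse {A B : Type*} [CommRing A] [IsDomain A]
    [CommRing B] [IsDomain B] [UniqueFactorizationMonoid B] (i : A →+* B) (φ : B →+* A)
    (h : Function.LeftInverse φ i) : UniqueFactorizationMonoid A := by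
  have hunit : ∀ a : A, IsUnit (i a) → IsUnit a := fun a ha => by simpa [h a] using ha.map φ
  have hwf : WfDvdMonoid A := ⟨by
    refine Subrelation.wf ?_ (InvImage.wf i (wellFounded_dvdNotUnit (α := B)))
    rintro a b ⟨ha, x, hx, rfl⟩
    exact ⟨by rwa [Ne, map_eq_zero_iff i h.injective], i x, fun hu => hx (hunit x hu), map_mul ..⟩⟩
  refine { hwf with irreducible_iff_prime := fun {a} => ⟨fun ha => ?_, Prime.irreducible⟩ }
  have hia : i a ≠ 0 := by rw [Ne, map_eq_zero_iff i h.injective]; exact ha.ne_zero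
  have key : ∃ p : B, Prime p ∧ p ∣ i a ∧ a ∣ φ p := by
    by_contra! hcon
    obtain ⟨s, hs, hsa⟩ := UniqueFactorizationMonoid.exists_prime_factors (i a) hia
    have hall : ∀ p ∈ s, IsUnit (φ p) := by
      intro p hp
      have hpa : p ∣ i a := (Multiset.dvd_prod hp).trans hsa.dvd
      obtain ⟨c, hc⟩ := hpa
      have hac : a = φ p * φ c := by rw [← map_mul, ← hc, h a]
      refine (ha.isUnit_or_isUnit hac).resolve_right fun hu => ?_
      refine hcon p (hs p hp) ⟨c, hc⟩ ?_
      rw [hac]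
      exact (hu.mul_right_dvd).2 dvd_rfl
    have hprod : Associated (φ s.prod) a := by
      simpa [h a] using hsa.map φ
    refine ha.not_isUnit (hprod.isUnit ?_)
    rw [map_multiset_prod]
    refine Multiset.prod_induction IsUnit _ (fun _ _ => IsUnit.mul) isUnit_one ?_
    simpa using hall
  obtain ⟨p, hp, hpa, hap⟩ := key
  refine ⟨ha.ne_zero, ha.not_isUnit, fun u v huv => ?_⟩
  have hdvd : ∀ w, p ∣ i w → a ∣ w := fun w hw =>
    hap.trans (by simpa [h w] using map_dvd φ hw)
  have : p ∣ i u * i v := by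
    rw [← map_mul]; exact hpa.trans (map_dvd i huv)
  exact (hp.dvd_or_dvd this).imp (hdvd u) (hdvd v)

open MvPolynomial in
/-- Under `finSuccEquiv`, polynomials not involving the first variable become constants. -/
theorem MvPolynomial.finSuccEquiv_rename_succ {R : Type*} [CommRing R] {n : ℕ}
    (q : MvPolynomial (Fin n) R) :
    finSuccEquiv R n (rename Fin.succ q) = Polynomial.C q := by
  induction q using MvPolynomial.induction_on with
  | C r => rw [rename_C, finSuccEquiv_apply]; simp
  | add p q hp hq => simp only [map_add, hp, hq]
  | mul_X p i hp => rw [map_mul, map_mul, hp, rename_X, finSuccEquiv_X_succ, map_mul]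

open MvPolynomial in
/-- Splitting off the largest power of the first variable from a nonzero polynomial. -/
theorem MvPolynomial.exists_eq_X_pow_mul_add_rename {R : Type*} [CommRing R] [IsDomain R]
    [UniqueFactorizationMonoid R] {n : ℕ} {P : MvPolynomial (Fin (n + 1)) R} (hP : P ≠ 0) :
    ∃ (k : ℕ) (p : MvPolynomial (Fin (n + 1)) R) (q : MvPolynomial (Fin n) R),
      q ≠ 0 ∧ P = X 0 ^ k * (X 0 * p + rename Fin.succ q) := by
  obtain ⟨k, a, hka, rfl⟩ :=
    WfDvdMonoid.max_power_factor hP (X_prime (R := R) (i := (0 : Fin (n + 1)))).irreducible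
  have ha : a = X 0 * (finSuccEquiv R n).symm (finSuccEquiv R n a).divX
      + rename Fin.succ ((finSuccEquiv R n a).coeff 0) := by
    apply (finSuccEquiv R n).injective
    rw [map_add, map_mul, finSuccEquiv_X_zero, AlgEquiv.apply_symm_apply,
      finSuccEquiv_rename_succ, Polynomial.X_mul_divX_add]
  refine ⟨k, _, _, fun h0 => hka ?_, congrArg _ ha⟩
  rw [h0, map_zero, add_zero] at ha
  exact ⟨_, ha⟩

section Augmentation

variable {R A : Type*} [CommRing R] [IsDomain R] [UniqueFactorizationMonoid R]
  [CommRing A] [IsDomain A] [Algebra R A]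

open MvPolynomial

/-- A nonzero element of the augmentation ideal is transcendental. -/
theorem algebraicIndependent_of_augmentation_eq_zero (ε : A →ₐ[R] R) {f : A} (hf : f ≠ 0)
    (hεf : ε f = 0) : AlgebraicIndependent R ![f] := by
  rw [algebraicIndependent_iff]
  intro P hP
  by_contra hP0
  obtain ⟨k, p, q, hq, rfl⟩ := exists_eq_X_pow_mul_add_rename hP0
  rw [eq_C_of_isEmpty q] at hP hq
  simp only [map_mul, map_pow, map_add, aeval_X, rename_C, aeval_C, mul_eq_zero,
    Matrix.cons_val_zero, pow_eq_zero_iff', hf, false_and, false_or] at hP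
  have := congrArg ε hP
  simp only [map_add, map_mul, hεf, zero_mul, zero_add, AlgHom.commutes, map_zero,
    Algebra.algebraMap_self, RingHom.id_apply] at this
  exact hq (by rw [this, map_zero])

/-- A prime element of the augmentation ideal divides every element of that ideal which is
algebraically dependent on it. -/
theorem Prime.dvd_of_not_algebraicIndependent (ε : A →ₐ[R] R) {f g : A} (hf : Prime f)
    (hεf : ε f = 0) (hεg : ε g = 0) (hfg : ¬ AlgebraicIndependent R ![f, g]) : f ∣ g := by
  rw [algebraicIndependent_iff] at hfg
  push Not at hfg
  obtain ⟨P, hP, hP0⟩ := hfg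
  obtain ⟨k, p, q, hq, rfl⟩ := exists_eq_X_pow_mul_add_rename hP0
  obtain ⟨l, p', q', hq', rfl⟩ := exists_eq_X_pow_mul_add_rename hq
  rw [eq_C_of_isEmpty q'] at hP hq'
  simp only [map_mul, map_pow, map_add, aeval_X, rename_X, rename_C, aeval_C, mul_eq_zero,
    Matrix.cons_val_zero, pow_eq_zero_iff', hf.ne_zero, false_and, false_or, Fin.succ_zero_eq_one,
    Matrix.cons_val_one] at hP
  have hdvd := (dvd_add_right (dvd_mul_right f _)).1 (hP ▸ dvd_zero f)
  rcases hf.dvd_or_dvd hdvd with h | h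
  · exact hf.dvd_of_dvd_pow h
  · have := map_dvd ε h
    simp only [map_add, map_mul, hεf, hεg, zero_mul, zero_add, AlgHom.commutes, zero_dvd_iff,
      Algebra.algebraMap_self, RingHom.id_apply] at this
    exact (hq' (by rw [this, map_zero])).elim

end Augmentation

open MvPolynomial in
/-- If `f` generates the augmentation ideal of a subalgebra of a polynomial ring, then it generates
the subalgebra. -/
theorem Subalgebra.aeval_surjective_of_dvd_augmentation {R σ : Type*} [CommRing R] [IsDomain R]
    (A : Subalgebra R (MvPolynomial σ R)) (ε : A →ₐ[R] R) {f : A} (hf : f ≠ 0) (hεf : ε f = 0)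
    (hdvd : ∀ g, ε g = 0 → f ∣ g) :
    Function.Surjective (aeval (R := R) ![f]) := by
  have hdeg : 0 < (f : MvPolynomial σ R).totalDegree := by
    refine Nat.pos_of_ne_zero fun h0 => hf ?_
    rw [totalDegree_eq_zero_iff_eq_C] at h0
    have hfc : f = algebraMap R A (coeff 0 (f : MvPolynomial σ R)) := Subtype.ext h0
    rw [hfc, AlgHom.commutes] at hεf
    rw [hfc, show coeff 0 (f : MvPolynomial σ R) = 0 from hεf, map_zero]
  suffices ∀ n, ∀ a : A, (a : MvPolynomial σ R).totalDegree = n →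
      ∃ P, aeval (R := R) ![f] P = a from fun a => this _ a rfl
  intro n
  induction n using Nat.strong_induction_on with
  | _ n ih =>
    intro a ha
    obtain ⟨b, hb⟩ := hdvd (a - algebraMap R A (ε a)) (by simp)
    by_cases hb0 : b = 0
    · refine ⟨C (ε a), ?_⟩
      rw [hb0, mul_zero, sub_eq_zero] at hb
      rw [aeval_C, ← hb]
    have hlt : (b : MvPolynomial σ R).totalDegree < n := by
      have h1 : (f * b : MvPolynomial σ R).totalDegree
          = (f : MvPolynomial σ R).totalDegree + (b : MvPolynomial σ R).totalDegree :=
        totalDegree_mul_of_isDomain (by simpa using hf) (by simpa using hb0)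
      have h2 : (f * b : MvPolynomial σ R) = (a : MvPolynomial σ R) - C (ε a) :=
        (congrArg Subtype.val hb).symm
      have h3 := totalDegree_sub_C_le (a : MvPolynomial σ R) (ε a)
      rw [h2] at h1
      omega
    obtain ⟨P, hP⟩ := ih _ hlt b rfl
    refine ⟨X 0 * P + C (ε a), ?_⟩
    rw [map_add, map_mul, aeval_X, hP, aeval_C, Matrix.cons_val_zero, ← hb, sub_add_cancel]

open MvPolynomial in
/-- A noninjective retraction of a polynomial ring in two variables has image of transcendence
degree at most one. -/
theorem not_algebraicIndependent_of_retract_not_injective {R : Type*} [CommRing R] [IsDomain R]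
    (A : Subalgebra R (MvPolynomial (Fin 2) R)) (φ : MvPolynomial (Fin 2) R →ₐ[R] A)
    (hφ : ∀ a : A, φ (a : MvPolynomial (Fin 2) R) = a) (hinj : ¬ Function.Injective φ)
    (f g : A) : ¬ AlgebraicIndependent R ![f, g] := by
  intro hfg
  rw [injective_iff_map_eq_zero] at hinj
  push Not at hinj
  obtain ⟨F, hF, hF0⟩ := hinj
  have hind : AlgebraicIndependent R (A.val ∘ ![f, g]) :=
    hfg.map' (f := A.val) Subtype.val_injective
  have hbasis := hind.isTranscendenceBasis_of_lift_trdeg_le_of_finite (by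
    rw [MvPolynomial.trdeg_of_isDomain]; simp)
  have halg := hbasis.isAlgebraic
  have hle : Algebra.adjoin R (Set.range (A.val ∘ ![f, g])) ≤ A := by
    rw [Algebra.adjoin_le_iff]
    rintro _ ⟨j, rfl⟩
    exact (![f, g] j).2
  obtain ⟨a, ha, hdvd⟩ :=
    (halg.isAlgebraic F).exists_nonzero_dvd (mem_nonZeroDivisors_of_ne_zero hF0)
  have h := map_dvd φ hdvd
  rw [hF, zero_dvd_iff] at h
  have h' : (⟨a, hle a.2⟩ : A) = 0 := (hφ ⟨a, hle a.2⟩).symm.trans h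
  exact ha (Subtype.ext (congrArg A.val h'))

/-- **Costa's theorem.**  Let `R` be a UFD and `A` an `R`-subalgebra of `R[x₁, x₂]` which is
an `R`-retract of `R[x₁, x₂]`.  Then `A ≅ R^{[s]}` as `R`-algebras for some `s ∈ {0, 1, 2}`. -/
theorem retract_of_poly2_over_UFD (R : Type*) [CommRing R] [IsDomain R]
    [UniqueFactorizationMonoid R]
    (A : Subalgebra R (MvPolynomial (Fin 2) R))
    (φ : MvPolynomial (Fin 2) R →ₐ[R] A)
    (hφ : ∀ a : A, φ (a : MvPolynomial (Fin 2) R) = a) :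
    ∃ s : ℕ, s ≤ 2 ∧ Nonempty (A ≃ₐ[R] MvPolynomial (Fin s) R) := by
  by_cases hinj : Function.Injective φ
  · exact ⟨2, le_rfl, ⟨(AlgEquiv.ofBijective φ ⟨hinj, fun a => ⟨a, hφ a⟩⟩).symm⟩⟩
  have hufd : UniqueFactorizationMonoid A :=
    .of_leftInverse A.val.toRingHom φ.toRingHom hφ
  let ε : A →ₐ[R] R := (MvPolynomial.aeval fun _ => 0).comp A.val
  by_cases hker : RingHom.ker ε = ⊥
  · have hbij : Function.Bijective (algebraMap R A) := by
      refine ⟨FaithfulSMul.algebraMap_injective R A, fun a => ⟨ε a, ?_⟩⟩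
      exact (RingHom.injective_iff_ker_eq_bot ε).2 hker (ε.commutes _)
    exact ⟨0, by omega, ⟨(AlgEquiv.ofBijective (Algebra.ofId R A) hbij).symm.trans
      (MvPolynomial.isEmptyAlgEquiv R (Fin 0)).symm⟩⟩
  · obtain ⟨f, hεf, hf⟩ := (RingHom.ker_isPrime ε).exists_mem_prime_of_ne_bot hker
    have hdvd : ∀ g, ε g = 0 → f ∣ g := fun g hg =>
      hf.dvd_of_not_algebraicIndependent ε hεf hg
        (not_algebraicIndependent_of_retract_not_injective A φ hφ hinj f g)
    exact ⟨1, by omega, ⟨(AlgEquiv.ofBijective (MvPolynomial.aeval ![f])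
      ⟨algebraicIndependent_of_augmentation_eq_zero ε hf.ne_zero hεf,
        A.aeval_surjective_of_dvd_augmentation ε hf.ne_zero hεf hdvd⟩).symm⟩⟩
end

section
/- Let R be an integral domain, 1 ≤ d ≤ n, B = R[x₁^{±1}, …, x_d^{±1}, x_{d+1}, …, xₙ], φ : B → B an R-algebra homomorphism with φ ∘ φ = φ, and A = φ(B). If the transcendence degree of the fraction field of A over the fraction field of R is 0, then A equals the image of R in B; if this transcendence degree equals n, then A = B. -/
/-- The transcendence degree of an `R`-algebra `A`: the supremum of the cardinalities of
algebraically independent subsets of `A` over `R`.  For an integral domain `A` over an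
integral domain `R` this equals the transcendence degree of `Q(A)` over `Q(R)`. -/
noncomputable def trdeg (R A : Type*) [CommRing R] [CommRing A] [Algebra R A] : Cardinal :=
  ⨆ s : { s : Set A // AlgebraicIndependent R ((↑) : s → A) }, Cardinal.mk s.1

/-- The mixed Laurent/polynomial ring `R[x₁^{±1}, …, x_d^{±1}, x_{d+1}, …, x_{d+m}]`,
realized as the monoid algebra of `ℤ^d × ℕ^m` over `R`. -/
abbrev MixedLaurent (R : Type*) [CommRing R] (d m : ℕ) : Type _ :=
  AddMonoidAlgebra R ((Fin d → ℤ) × (Fin m → ℕ))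

theorem trdeg_eq_algebra_trdeg (R A : Type*) [CommRing R] [CommRing A] [Algebra R A] :
    trdeg R A = Algebra.trdeg R A := rfl

namespace AddMonoidAlgebra

/-- An element of a monoid algebra over a domain, with torsion-free exponents, which is algebraic
over the base ring is a constant. -/
theorem mem_bot_of_isAlgebraic {R M : Type*} [CommRing R] [AddCommMonoid M]
    [IsAddTorsionFree M] [IsCancelAdd M] [IsDomain (AddMonoidAlgebra R M)]
    {f : AddMonoidAlgebra R M} (hf : IsAlgebraic R f) :
    f ∈ (⊥ : Subalgebra R (AddMonoidAlgebra R M)) := by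
  obtain ⟨p, hp, hpf⟩ := hf
  have inj : Function.Injective (algebraMap R (AddMonoidAlgebra R M)) :=
    fun a b h ↦ by simpa using congrArg (fun g ↦ g.coeff 0) h
  have fin : (p.rootSet (AddMonoidAlgebra R M)).Finite := Set.toFinite _
  let θ (k : ℕ) : AddMonoidAlgebra R M →ₐ[R] AddMonoidAlgebra R M :=
    mapDomainAlgHom R R (nsmulAddMonoidHom (k + 1))
  have hθ (k : ℕ) : θ k f ∈ p.rootSet (AddMonoidAlgebra R M) := by
    rw [Polynomial.mem_rootSet']
    refine ⟨(Polynomial.map_ne_zero_iff inj).2 hp, ?_⟩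
    rw [Polynomial.aeval_algHom_apply, hpf, map_zero]
  have hcoeff (k : ℕ) (m : M) : (θ k f).coeff ((k + 1) • m) = f.coeff m := by
    simp only [θ, mapDomainAlgHom_apply, coeff_mapDomain]
    exact Finsupp.mapDomain_apply (nsmul_right_injective k.succ_ne_zero) f.coeff m
  have hsupp (m : M) (hm : m ≠ 0) : f.coeff m = 0 := by
    by_contra hne
    have hU : (⋃ g ∈ p.rootSet (AddMonoidAlgebra R M), (g.coeff.support : Set M)).Finite :=
      fin.biUnion fun g _ ↦ g.coeff.support.finite_toSet
    refine Set.infinite_of_injective_forall_mem (f := fun k : ℕ ↦ (k + 1) • m) ?_ (fun k ↦ ?_) hU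
    · refine Function.Injective.of_lt_imp_ne fun a b hab h ↦ ?_
      obtain ⟨c, rfl⟩ := Nat.exists_eq_add_of_lt hab
      have : (a + c + 1 + 1) • m = (a + 1) • m + (c + 1) • m := by rw [← add_nsmul]; congr 1; omega
      simp only [this, left_eq_add, nsmul_eq_zero_iff_left hm] at h
      omega
    · refine Set.mem_biUnion (hθ k) ?_
      simpa [hcoeff] using hne
  rw [Algebra.mem_bot]
  refine ⟨f.coeff 0, ?_⟩
  ext m
  by_cases hm : m = 0
  · simp [hm]
  · simp [hsupp m hm, hm]

end AddMonoidAlgebra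

namespace MixedLaurent

open AddMonoidAlgebra

/-- The variables `x₁, …, xₙ` of the mixed Laurent/polynomial ring. -/
noncomputable def var (R : Type*) [CommRing R] (d m : ℕ) : Fin d ⊕ Fin m → MixedLaurent R d m :=
  Sum.elim (fun i ↦ single (Pi.single i 1, 0) 1) (fun j ↦ single (0, Pi.single j 1) 1)

variable (R : Type*) [CommRing R] [IsDomain R] (d m : ℕ)

theorem isAlgebraic_adjoin_var :
    Algebra.IsAlgebraic (Algebra.adjoin R (Set.range (var R d m))) (MixedLaurent R d m) := by
  set S := Algebra.adjoin R (Set.range (var R d m))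
  let T : AddSubmonoid ((Fin d → ℤ) × (Fin m → ℕ)) :=
    { carrier := {e | IsAlgebraic S (single e 1 : MixedLaurent R d m)}
      zero_mem' := isAlgebraic_one
      add_mem' := fun {a b} ha hb ↦ by
        simpa [single_mul_single] using IsAlgebraic.mul ha hb }
  have hvar (i) : IsAlgebraic S (var R d m i) :=
    isAlgebraic_algebraMap (⟨_, Algebra.subset_adjoin ⟨i, rfl⟩⟩ : S)
  have hpos (i : Fin d) : ((Pi.single i 1, 0) : (Fin d → ℤ) × (Fin m → ℕ)) ∈ T := hvar (.inl i)
  have hneg (i : Fin d) : -(Pi.single i 1 : Fin d → ℤ) = Pi.single i (-1) :=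
    (Pi.single_neg i 1).symm
  have hinv (i : Fin d) : ((Pi.single i (-1), 0) : (Fin d → ℤ) × (Fin m → ℕ)) ∈ T := by
    refine IsAlgebraic.of_mul (mem_nonZeroDivisors_of_ne_zero ?_) (hpos i) ?_
    · simp
    · rw [single_mul_single, ← hneg]
      simpa [one_def, ← Prod.zero_eq_mk] using isAlgebraic_one (R := S) (A := MixedLaurent R d m)
  have hz (i : Fin d) (k : ℤ) : ((Pi.single i k, 0) : (Fin d → ℤ) × (Fin m → ℕ)) ∈ T := by
    obtain ⟨n, rfl | rfl⟩ := k.eq_nat_or_neg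
    · simpa [← Pi.single_smul'] using T.nsmul_mem (hpos i) n
    · simpa [← Pi.single_smul'] using T.nsmul_mem (hinv i) n
  have hn (j : Fin m) (k : ℕ) : ((0, Pi.single j k) : (Fin d → ℤ) × (Fin m → ℕ)) ∈ T := by
    simpa [← Pi.single_smul'] using T.nsmul_mem (hvar (.inr j)) k
  have hT (e) : e ∈ T := by
    have h1 := T.sum_mem fun i (_ : i ∈ Finset.univ) ↦ hz i (e.1 i)
    have h2 := T.sum_mem fun j (_ : j ∈ Finset.univ) ↦ hn j (e.2 j)
    convert T.add_mem h1 h2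
    ext i <;> simp [Prod.fst_sum, Prod.snd_sum, Finset.sum_apply, Pi.single_apply]
  refine ⟨fun f ↦ ?_⟩
  induction f using AddMonoidAlgebra.induction_linear with
  | zero => exact isAlgebraic_zero
  | add f g hf hg => exact hf.add hg
  | single e r =>
    have := IsAlgebraic.smul (hT e) (algebraMap R S r)
    simpa [Algebra.smul_def] using this

theorem algebra_trdeg_le : Algebra.trdeg R (MixedLaurent R d m) ≤ ((d + m : ℕ) : Cardinal) := by
  have := isAlgebraic_adjoin_var R d m
  refine (Algebra.IsAlgebraic.trdeg_le_cardinalMk R (Set.range (var R d m))).trans ?_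
  have := Cardinal.mk_range_le_lift (f := var R d m)
  simpa using this

end MixedLaurent

/-- An idempotent endomorphism of a domain which is algebraic over the image is surjective. -/
theorem AlgHom.range_eq_top_of_isAlgebraic_of_comp_self {R B : Type*} [CommRing R] [CommRing B]
    [IsDomain B] [Algebra R B] {φ : B →ₐ[R] B} (hφ : φ.comp φ = φ)
    [Algebra.IsAlgebraic φ.range B] : φ.range = ⊤ := by
  have hφ' (x : B) : φ (φ x) = φ x := DFunLike.congr_fun hφ x
  have inj : Function.Injective φ := by
    rw [injective_iff_map_eq_zero]
    intro b hb
    by_contra hne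
    obtain ⟨⟨r, a, rfl⟩, hr, c, hc⟩ := (Algebra.IsAlgebraic.isAlgebraic (R := φ.range)
      b).exists_nonzero_dvd (mem_nonZeroDivisors_of_ne_zero hne)
    refine hr (Subtype.ext ?_)
    have := congrArg φ hc
    rw [map_mul, hb, zero_mul] at this
    exact (hφ' a).symm.trans this
  rw [AlgHom.range_eq_top]
  exact fun b ↦ ⟨b, inj (hφ' b)⟩

/-- Let `R` be an integral domain, `1 ≤ d`, `B = R[x₁^{±1}, …, x_d^{±1}, x_{d+1}, …, xₙ]`
(with `n = d + m`), `φ : B → B` an idempotent `R`-algebra endomorphism and `A = φ(B)`.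
If `tr.deg_R A = 0` then `A` is the image of `R` in `B`; if `tr.deg_R A = n` then `A = B`. -/
theorem retract_trdeg_extreme (R : Type*) [CommRing R] [IsDomain R] (d m : ℕ) (hd : 1 ≤ d)
    (φ : MixedLaurent R d m →ₐ[R] MixedLaurent R d m) (hφ : φ.comp φ = φ) :
    (trdeg R φ.range = 0 → φ.range = ⊥) ∧
    (trdeg R φ.range = ((d + m : ℕ) : Cardinal) → φ.range = ⊤) := by
  constructor
  · intro h
    rw [trdeg_eq_algebra_trdeg, trdeg_eq_zero_iff] at h
    refine le_bot_iff.1 fun f hf ↦ AddMonoidAlgebra.mem_bot_of_isAlgebraic ?_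
    exact (h.isAlgebraic ⟨f, hf⟩).algebraMap
  · intro h
    have hadd := trdeg_add_eq R φ.range (A := MixedLaurent R d m)
    rw [← trdeg_eq_algebra_trdeg R φ.range, h] at hadd
    have hle := hadd.trans_le (MixedLaurent.algebra_trdeg_le R d m)
    have hzero : Algebra.trdeg φ.range (MixedLaurent R d m) = 0 := by
      refine Cardinal.eq_of_add_eq_add_left (a := ((d + m : ℕ) : Cardinal)) ?_
        (Cardinal.natCast_lt_aleph0)
      rw [add_zero]
      exact hle.antisymm (by simp)
    have := trdeg_eq_zero_iff.1 hzero
    exact AlgHom.range_eq_top_of_isAlgebraic_of_comp_self hφ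
end

section
/- Let R be an integral domain, 1 ≤ d ≤ n, B = R[x₁^{±1}, …, x_d^{±1}, x_{d+1}, …, xₙ], φ : B → B an R-algebra homomorphism with φ ∘ φ = φ, A = φ(B), and r the rank of the abelian group U_R(A) = A^*/R^*. Then there exist units y₁, …, y_d ∈ B^* such that (i) B = R[y₁^{±1}, …, y_d^{±1}, x_{d+1}, …, xₙ], meaning the R-algebra homomorphism from the Laurent-mixed ring R[t₁^{±1}, …, t_d^{±1}, t_{d+1}, …, tₙ] to B sending tᵢ ↦ yᵢ for i ≤ d and t_j ↦ x_j for j > d is an isomorphism, and (ii) φ(yᵢ) = yᵢ for 1 ≤ i ≤ r and φ(yᵢ) = 1 for r + 1 ≤ i ≤ d. -/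
/-- The (torsion-free) rank of an abelian group, written multiplicatively. -/
noncomputable def groupRank (G : Type*) [CommGroup G] : Cardinal :=
  @Module.rank ℤ (Additive G) _ _ (AddCommGroup.toIntModule _)

/-- The `i`-th invertible (Laurent) variable `xᵢ`, `1 ≤ i ≤ d`. -/
noncomputable def lVar (R : Type*) [CommRing R] (d m : ℕ) (i : Fin d) : MixedLaurent R d m :=
  AddMonoidAlgebra.single (Pi.single i 1, 0) 1

/-- The `j`-th polynomial variable `x_{d+j}`. -/
noncomputable def pVar (R : Type*) [CommRing R] (d m : ℕ) (j : Fin m) : MixedLaurent R d m :=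
  AddMonoidAlgebra.single (0, Pi.single j 1) 1

/-- `U_R(A) = A^*/R^*`, the quotient of the unit group of `A` by the image of `R^*`. -/
abbrev URGroup (R A : Type*) [CommRing R] [CommRing A] [Algebra R A] : Type _ :=
  Aˣ ⧸ (Units.map (algebraMap R A : R →* A)).range

section UnitsOfMonoidAlgebra

variable {R M : Type*} [CommRing R] [IsDomain R] [AddCommMonoid M] [TwoUniqueSums M]

/-- The units of a monoid algebra over a domain are monomials if the monoid has two unique sums. -/
theorem AddMonoidAlgebra.exists_eq_single_of_isUnit_s8 {x : AddMonoidAlgebra R M} (hx : IsUnit x) :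
    ∃ (a : M) (u : Rˣ), IsAddUnit a ∧ x = AddMonoidAlgebra.single a (u : R) := by
  classical
  obtain ⟨y, hxy⟩ := hx.exists_right_inv
  have hx0 : x ≠ 0 := by rintro rfl; simp at hxy
  have hy0 : y ≠ 0 := by rintro rfl; simp at hxy
  have hone : ∀ a ∈ x.coeff.support, ∀ b ∈ y.coeff.support,
      UniqueAdd x.coeff.support y.coeff.support a b → a + b = 0 := by
    intro a ha b hb hab
    by_contra hne
    have h := AddMonoidAlgebra.coeff_mul_add_of_uniqueAdd hab
    rw [hxy, AddMonoidAlgebra.one_def, AddMonoidAlgebra.coeff_single,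
      Finsupp.single_eq_of_ne hne] at h
    exact mul_ne_zero (Finsupp.mem_support_iff.1 ha) (Finsupp.mem_support_iff.1 hb) h.symm
  have hcard : x.coeff.support.card * y.coeff.support.card ≤ 1 := by
    by_contra! hlt
    obtain ⟨p, hp, q, hq, hne, hup, huq⟩ := TwoUniqueSums.uniqueAdd_of_one_lt_card hlt
    rw [Finset.mem_product] at hp hq
    have h := huq hp.1 hp.2 ((hone _ hp.1 _ hp.2 hup).trans (hone _ hq.1 _ hq.2 huq).symm)
    exact hne (Prod.ext h.1 h.2)
  have hxs : 0 < x.coeff.support.card := by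
    rw [Finset.card_pos, Finsupp.support_nonempty_iff]; simpa using hx0
  have hys : 0 < y.coeff.support.card := by
    rw [Finset.card_pos, Finsupp.support_nonempty_iff]; simpa using hy0
  obtain ⟨a, r, hr, hxa⟩ := Finsupp.card_support_eq_one'.1
    (show x.coeff.support.card = 1 by nlinarith)
  obtain ⟨b, s, hs, hyb⟩ := Finsupp.card_support_eq_one'.1
    (show y.coeff.support.card = 1 by nlinarith)
  have hxa' : x = AddMonoidAlgebra.single a r := by
    ext1; simpa using hxa
  have hyb' : y = AddMonoidAlgebra.single b s := by
    ext1; simpa using hyb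
  rw [hxa', hyb', AddMonoidAlgebra.single_mul_single, AddMonoidAlgebra.one_def,
    AddMonoidAlgebra.single_inj] at hxy
  obtain ⟨hab, hrs⟩ | ⟨-, h⟩ := hxy
  · exact ⟨a, Units.mkOfMulEqOne r s hrs, ⟨⟨a, b, hab, by rw [add_comm, hab]⟩, rfl⟩, hxa'⟩
  · exact absurd h one_ne_zero

end UnitsOfMonoidAlgebra

/-- A basis of `ℤ^d` adapted to an idempotent endomorphism. -/
theorem LinearMap.exists_adapted_equiv_of_idempotent {d r : ℕ}
    (P : (Fin d → ℤ) →ₗ[ℤ] (Fin d → ℤ)) (hP : ∀ a, P (P a) = P a)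
    (hr : Module.finrank ℤ P.range = r) :
    ∃ E : (Fin d → ℤ) ≃ₗ[ℤ] (Fin d → ℤ),
      (∀ i : Fin d, (i : ℕ) < r → P (E (Pi.single i 1)) = E (Pi.single i 1)) ∧
      (∀ i : Fin d, r ≤ (i : ℕ) → P (E (Pi.single i 1)) = 0) := by
  have hcompl : IsCompl P.range P.ker := by
    have h := LinearMap.isCompl_of_proj (f := P.rangeRestrict)
      (by rintro ⟨_, a, rfl⟩; exact Subtype.ext (hP a))
    rwa [LinearMap.ker_rangeRestrict] at h
  let b := ((Module.finBasis ℤ P.range).prod (Module.finBasis ℤ P.ker)).map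
    (Submodule.prodEquivOfIsCompl _ _ hcompl)
  have hd : Module.finrank ℤ P.range + Module.finrank ℤ P.ker = d := by
    have h := Module.finrank_eq_card_basis b
    simpa using h.symm
  let e := finSumFinEquiv.trans (finCongr hd)
  let b' := b.reindex e
  refine ⟨(Pi.basisFun ℤ (Fin d)).equiv b' (Equiv.refl _), fun i hi ↦ ?_, fun i hi ↦ ?_⟩
  all_goals
    rw [← Pi.basisFun_apply, Module.Basis.equiv_apply, Equiv.refl_apply, Module.Basis.reindex_apply]
    obtain ⟨j, rfl⟩ := e.surjective i
    rw [Equiv.symm_apply_apply]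
    rcases j with j | j
  · have hmem : b (Sum.inl j) ∈ P.range := by simp [b]
    obtain ⟨a, ha⟩ := hmem
    rw [← ha, hP]
  · simp [e, hr] at hi
  · have := j.isLt
    simp [e] at hi
    omega
  · have hmem : b (Sum.inr j) ∈ P.ker := by simp [b]
    exact hmem

namespace MixedLaurent

open AddMonoidAlgebra

variable {R : Type*} [CommRing R] {d m : ℕ}

/-- The twisted monomial map: `x^a ↦ χ(a) x^{E a}` on Laurent monomials, identity on the
polynomial variables. -/
noncomputable def twist (E : (Fin d → ℤ) →ₗ[ℤ] (Fin d → ℤ))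
    (χ : Multiplicative (Fin d → ℤ) →* Rˣ) :
    MixedLaurent R d m →ₐ[R] MixedLaurent R d m :=
  AddMonoidAlgebra.lift R (MixedLaurent R d m) ((Fin d → ℤ) × (Fin m → ℕ))
    { toFun := fun p ↦ single (E p.toAdd.1, p.toAdd.2) (χ (Multiplicative.ofAdd p.toAdd.1) : R)
      map_one' := by simp [one_def, ← Prod.mk_zero_zero]
      map_mul' := fun p q ↦ by simp [single_mul_single] }

theorem twist_single (E : (Fin d → ℤ) →ₗ[ℤ] (Fin d → ℤ)) (χ : Multiplicative (Fin d → ℤ) →* Rˣ)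
    (a : Fin d → ℤ) (b : Fin m → ℕ) (s : R) :
    twist E χ (single (a, b) s : MixedLaurent R d m) =
      single (E a, b) (s * (χ (Multiplicative.ofAdd a) : R)) := by
  simp [twist, lift_single]

/-- The automorphism `x^a ↦ χ(a) x^{E a}` for `E` invertible. -/
noncomputable def twistEquiv (E : (Fin d → ℤ) ≃ₗ[ℤ] (Fin d → ℤ))
    (χ : Multiplicative (Fin d → ℤ) →* Rˣ) : MixedLaurent R d m ≃ₐ[R] MixedLaurent R d m :=
  AlgEquiv.ofAlgHom (twist E.toLinearMap χ)
    (twist E.symm.toLinearMap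
      (χ⁻¹.comp (AddMonoidHom.toMultiplicative E.symm.toLinearMap.toAddMonoidHom)))
    (by
      ext ⟨a, b⟩ : 1
      · simp [twist_single]
      · exact Subsingleton.elim _ _)
    (by
      ext ⟨a, b⟩ : 1
      · simp [twist_single]
      · exact Subsingleton.elim _ _)

/-- Laurent monomials are units. -/
theorem isUnit_single (a : Fin d → ℤ) : IsUnit (single (a, 0) 1 : MixedLaurent R d m) :=
  IsUnit.of_mul_eq_one (single (-a, 0) 1)
    (by simp [single_mul_single, one_def, ← Prod.mk_zero_zero])

variable [IsDomain R]

/-- The units of the mixed ring are the Laurent monomials with unit coefficients. -/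
theorem exists_eq_single_of_isUnit_s8 {x : MixedLaurent R d m} (hx : IsUnit x) :
    ∃ (b : Fin d → ℤ) (u : Rˣ), x = single (b, 0) (u : R) := by
  obtain ⟨⟨b, n⟩, u, hadd, rfl⟩ := AddMonoidAlgebra.exists_eq_single_of_isUnit_s8 hx
  obtain ⟨k, hk⟩ := isAddUnit_iff_exists_neg.1 hadd
  obtain rfl : n = 0 := by
    funext j
    exact Nat.eq_zero_of_add_eq_zero_right (congrFun (congrArg Prod.snd hk) j)
  exact ⟨b, u, rfl⟩

/-- An endomorphism sends each Laurent monomial to a unit multiple of a Laurent monomial. -/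
theorem exists_exponent_map (φ : MixedLaurent R d m →ₐ[R] MixedLaurent R d m) :
    ∃ (P : (Fin d → ℤ) →ₗ[ℤ] (Fin d → ℤ)) (c : Multiplicative (Fin d → ℤ) →* Rˣ),
      ∀ (a : Fin d → ℤ) (s : R), φ (single (a, 0) s) =
        single (P a, 0) (s * (c (Multiplicative.ofAdd a) : R)) := by
  have h (a : Fin d → ℤ) : ∃ (b : Fin d → ℤ) (u : Rˣ),
      φ (single (a, 0) 1) = single (b, 0) (u : R) := by
    exact exists_eq_single_of_isUnit_s8 ((isUnit_single a).map φ)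
  choose P c hPc using h
  have hadd (a b : Fin d → ℤ) : P (a + b) = P a + P b ∧ c (a + b) = c a * c b := by
    have hs : (single (a + b, 0) 1 : MixedLaurent R d m) = single (a, 0) 1 * single (b, 0) 1 := by
      simp [single_mul_single]
    have hmul := congrArg φ hs
    rw [map_mul, hPc, hPc, hPc, single_mul_single, single_inj] at hmul
    obtain ⟨h1, h2⟩ | ⟨h1, -⟩ := hmul
    · exact ⟨congrArg Prod.fst h1, Units.ext (by simpa using h2)⟩
    · exact absurd h1 (c (a + b)).ne_zero
  refine ⟨(AddMonoidHom.mk' P fun a b ↦ (hadd a b).1).toIntLinearMap,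
    MonoidHom.mk' (fun a ↦ c a.toAdd) fun a b ↦ (hadd a.toAdd b.toAdd).2, fun a s ↦ ?_⟩
  have hs : (single (a, 0) s : MixedLaurent R d m) = s • single (a, 0) 1 := by simp
  rw [hs, map_smul, hPc]
  simp

/-- The rank of `U_R(φ(B))` is the rank of the exponent lattice fixed by `φ`. -/
theorem toNat_groupRank_range (φ : MixedLaurent R d m →ₐ[R] MixedLaurent R d m)
    (P : (Fin d → ℤ) →ₗ[ℤ] (Fin d → ℤ)) (c : Multiplicative (Fin d → ℤ) →* Rˣ)
    (hφ : ∀ (a : Fin d → ℤ) (s : R),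
      φ (single (a, 0) s) = single (P a, 0) (s * (c (Multiplicative.ofAdd a) : R)))
    (hfix : ∀ a ∈ P.range, φ (single (a, 0) 1) = single (a, 0) 1)
    (hidem : φ.comp φ = φ) :
    Cardinal.toNat (groupRank (URGroup R φ.range)) = Module.finrank ℤ P.range := by
  let mono : Multiplicative P.range →* φ.range :=
    { toFun := fun a ↦ ⟨single ((a.toAdd : Fin d → ℤ), 0) 1, _, hfix _ a.toAdd.2⟩
      map_one' := Subtype.ext (by simp [one_def, ← Prod.mk_zero_zero])
      map_mul' := fun a b ↦ Subtype.ext (by simp [single_mul_single]) }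
  let f : Multiplicative P.range →* URGroup R φ.range :=
    (QuotientGroup.mk' _).comp mono.toHomUnits
  have hinj : Function.Injective f := by
    rw [injective_iff_map_eq_one]
    intro a ha
    obtain ⟨u, hu⟩ := (QuotientGroup.eq_one_iff _).1 ha
    have hu' : (single 0 (u : R) : MixedLaurent R d m) =
        single ((a.toAdd : Fin d → ℤ), 0) 1 :=
      congrArg (fun v : (φ.range)ˣ ↦ ((v : φ.range) : MixedLaurent R d m)) hu
    rw [single_inj] at hu'
    obtain ⟨h, -⟩ | ⟨h, -⟩ := hu'
    · exact Multiplicative.toAdd.injective (Subtype.ext (congrArg Prod.fst h).symm)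
    · exact absurd h u.ne_zero
  have hsurj : Function.Surjective f := by
    intro q
    obtain ⟨v, rfl⟩ := QuotientGroup.mk_surjective q
    obtain ⟨b, u, hu⟩ := exists_eq_single_of_isUnit_s8 (v.isUnit.map φ.range.val)
    replace hu : ((v : φ.range) : MixedLaurent R d m) = single (b, 0) (u : R) := hu
    obtain ⟨w, hw⟩ := (v : φ.range).2
    have hv : φ (single (b, 0) (u : R)) = single (b, 0) (u : R) := by
      rw [← hu, ← hw]
      exact DFunLike.congr_fun hidem w
    have hb : b ∈ P.range := by
      rw [hφ, single_inj] at hv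
      obtain ⟨h, -⟩ | ⟨-, h⟩ := hv
      · exact ⟨b, congrArg Prod.fst h⟩
      · exact absurd h u.ne_zero
    refine ⟨Multiplicative.ofAdd ⟨b, hb⟩, QuotientGroup.eq.2 ⟨u, ?_⟩⟩
    rw [eq_inv_mul_iff_mul_eq]
    refine Units.ext (Subtype.ext ?_)
    rw [hu]
    change single (b, 0) 1 * single 0 (u : R) = _
    simp [single_mul_single]
  exact ((MulEquiv.toAdditiveRight (MulEquiv.ofBijective f ⟨hinj, hsurj⟩)).toIntLinearEquiv.finrank_eq).symm

end MixedLaurent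

/-- Let `R` be an integral domain, `1 ≤ d`, `B = R[x₁^{±1}, …, x_d^{±1}, x_{d+1}, …, xₙ]`
(with `n = d + m`), `φ` an idempotent `R`-algebra endomorphism of `B`, `A = φ(B)` and
`r = rank U_R(A)`.  Then there are units `y₁, …, y_d` of `B` such that
`B = R[y₁^{±1}, …, y_d^{±1}, x_{d+1}, …, xₙ]` — i.e. there is an `R`-algebra automorphism of
`B` sending `xᵢ ↦ yᵢ` for `i ≤ d` and fixing the `x_j`, `j > d` — with `φ(yᵢ) = yᵢ` for
`1 ≤ i ≤ r` and `φ(yᵢ) = 1` for `r + 1 ≤ i ≤ d`. -/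
theorem exists_good_laurent_coordinates (R : Type*) [CommRing R] [IsDomain R] (d m : ℕ)
    (hd : 1 ≤ d)
    (φ : MixedLaurent R d m →ₐ[R] MixedLaurent R d m) (hφ : φ.comp φ = φ)
    (r : ℕ) (hr : groupRank (URGroup R φ.range) = (r : Cardinal)) :
    ∃ y : Fin d → (MixedLaurent R d m)ˣ,
      (∃ ψ : MixedLaurent R d m ≃ₐ[R] MixedLaurent R d m,
        (∀ i : Fin d, ψ (lVar R d m i) = (y i : MixedLaurent R d m)) ∧
        (∀ j : Fin m, ψ (pVar R d m j) = pVar R d m j)) ∧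
      (∀ i : Fin d, (i : ℕ) < r → φ ((y i : MixedLaurent R d m)) = (y i : MixedLaurent R d m)) ∧
      (∀ i : Fin d, r ≤ (i : ℕ) → φ ((y i : MixedLaurent R d m)) = 1) := by
  obtain ⟨P, c, hPc⟩ := MixedLaurent.exists_exponent_map φ
  have hidem (a : Fin d → ℤ) : P (P a) = P a ∧ c (Multiplicative.ofAdd (P a)) = 1 := by
    have h := DFunLike.congr_fun hφ (AddMonoidAlgebra.single (a, 0) 1)
    rw [AlgHom.comp_apply, hPc, hPc, AddMonoidAlgebra.single_inj] at h
    obtain ⟨h1, h2⟩ | ⟨-, h⟩ := h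
    · exact ⟨congrArg Prod.fst h1, Units.ext (by simpa using h2)⟩
    · simp at h
  have hrank : Module.finrank ℤ P.range = r := by
    rw [← MixedLaurent.toNat_groupRank_range φ P c hPc ?_ hφ, hr, Cardinal.toNat_natCast]
    rintro _ ⟨a, rfl⟩
    rw [hPc, (hidem a).1, (hidem a).2, Units.val_one, mul_one]
  obtain ⟨E, hE1, hE2⟩ := P.exists_adapted_equiv_of_idempotent (fun a ↦ (hidem a).1) hrank
  let ψ : MixedLaurent R d m ≃ₐ[R] MixedLaurent R d m :=
    MixedLaurent.twistEquiv E (c⁻¹.comp (AddMonoidHom.toMultiplicative E.toAddMonoidHom))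
  have hψ (i : Fin d) : ψ (lVar R d m i) = AddMonoidAlgebra.single (E (Pi.single i 1), 0)
      (((c (Multiplicative.ofAdd (E (Pi.single i 1))))⁻¹ : Rˣ) : R) := by
    refine (MixedLaurent.twist_single _ _ _ _ _).trans ?_
    simp
  have hφψ (i : Fin d) : φ (ψ (lVar R d m i)) =
      AddMonoidAlgebra.single (P (E (Pi.single i 1)), 0) 1 := by
    rw [hψ, hPc, Units.inv_mul]
  have hunit (i : Fin d) : IsUnit (ψ (lVar R d m i)) :=
    (MixedLaurent.isUnit_single _).map ψ
  refine ⟨fun i ↦ (hunit i).unit, ⟨ψ, fun i ↦ rfl, fun j ↦ ?_⟩, fun i hi ↦ ?_, fun i hi ↦ ?_⟩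
  · refine (MixedLaurent.twist_single _ _ _ _ _).trans ?_
    simp [pVar]
  · rw [IsUnit.unit_spec, hφψ, hψ, ← hE1 i hi, (hidem _).1, (hidem _).2, inv_one, Units.val_one]
  · rw [IsUnit.unit_spec, hφψ, hE2 i hi, AddMonoidAlgebra.one_def, Prod.mk_zero_zero]
end

section
/- Let R be an integral domain, 1 ≤ d ≤ n, B = R[x₁^{±1}, …, x_d^{±1}, x_{d+1}, …, xₙ], φ : B → B an R-algebra homomorphism with φ ∘ φ = φ, and A = φ(B). Suppose y₁, …, y_d ∈ B^* satisfy B = R[y₁^{±1}, …, y_d^{±1}, x_{d+1}, …, xₙ], φ(yᵢ) = yᵢ for 1 ≤ i ≤ r and φ(yᵢ) = 1 for r + 1 ≤ i ≤ d; set S = R[y₁^{±1}, …, y_r^{±1}] and J = (y_{r+1} − 1, …, y_d − 1)B. Then the quotient map π : B → B/J restricts to an injective S-algebra homomorphism on A, its image C = π(A) is an S-retract of B/J, and B/J is S-algebra isomorphic to the polynomial ring S^{[n−d]}; hence A is S-algebra isomorphic to an S-retract of S^{[n−d]}. -/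
namespace MixedLaurent

variable {R : Type*} [CommRing R] {d m : ℕ} {A : Type*} [CommRing A] [Algebra R A]

/-- Algebra homomorphisms out of the mixed Laurent/polynomial ring are determined by their values
on the variables. -/
theorem algHom_ext {f g : MixedLaurent R d m →ₐ[R] A}
    (hl : ∀ i, f (lVar R d m i) = g (lVar R d m i))
    (hp : ∀ j, f (pVar R d m j) = g (pVar R d m j)) : f = g := by
  refine AddMonoidAlgebra.algHom_ext' ?_ (Subsingleton.elim _ _)
  apply MonoidHom.toAdditiveRight.injective
  set f' := MonoidHom.toAdditiveRight ((f : MixedLaurent R d m →* A).comp (AddMonoidAlgebra.of R _))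
  set g' := MonoidHom.toAdditiveRight ((g : MixedLaurent R d m →* A).comp (AddMonoidAlgebra.of R _))
  change f' = g'
  rw [← AddMonoidHom.coprod_unique f', ← AddMonoidHom.coprod_unique g']
  congr 1
  · ext i
    exact hl i
  · ext j
    exact hp j

/-- The algebra homomorphism sending the Laurent variables to given units and the polynomial
variables to given elements. -/
noncomputable def lift (u : Fin d → Aˣ) (v : Fin m → A) : MixedLaurent R d m →ₐ[R] A :=
  AddMonoidAlgebra.lift R A ((Fin d → ℤ) × (Fin m → ℕ))
    { toFun := fun a => ((∏ i, u i ^ a.toAdd.1 i : Aˣ) : A) * ∏ j, v j ^ a.toAdd.2 j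
      map_one' := by simp
      map_mul' := fun a b => by
        simp only [toAdd_mul, Prod.fst_add, Prod.snd_add, Pi.add_apply, zpow_add, pow_add,
          Finset.prod_mul_distrib, Units.val_mul]
        ring }

@[simp]
theorem lift_lVar (u : Fin d → Aˣ) (v : Fin m → A) (i : Fin d) :
    lift u v (lVar R d m i) = u i := by
  have h : ∏ k, u k ^ (Pi.single i 1 : Fin d → ℤ) k = u i := by
    rw [Finset.prod_eq_single i] <;> simp +contextual
  simp [lift, lVar, h, -Units.coe_prod]

@[simp]
theorem lift_pVar (u : Fin d → Aˣ) (v : Fin m → A) (j : Fin m) :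
    lift u v (pVar R d m j) = v j := by
  have h : ∏ k, v k ^ (Pi.single j 1 : Fin m → ℕ) k = v j := by
    rw [Finset.prod_eq_single j] <;> simp +contextual
  simp [lift, pVar, h]

end MixedLaurent

/-- Algebra homomorphisms out of a subalgebra generated by units and their inverses are determined
by their values on these units. -/
theorem Subalgebra.algHom_ext_of_adjoin_units {R B A ι : Type*} [CommRing R] [CommRing B]
    [Algebra R B] [Semiring A] [Algebra R A] {S : Subalgebra R B} {p : ι → Prop} {y : ι → Bˣ}
    (hS : S = Algebra.adjoin R {b : B | ∃ i, p i ∧ (b = (y i : B) ∨ b = ((y i)⁻¹ : Bˣ))})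
    {f g : S →ₐ[R] A} (h : ∀ i, p i → ∀ hi : (y i : B) ∈ S, f ⟨y i, hi⟩ = g ⟨y i, hi⟩) :
    f = g := by
  have hy (i) (hi : p i) : (y i : B) ∈ S := hS ▸ Algebra.subset_adjoin ⟨i, hi, Or.inl rfl⟩
  have hy' (i) (hi : p i) : ((y i)⁻¹ : Bˣ).val ∈ S :=
    hS ▸ Algebra.subset_adjoin ⟨i, hi, Or.inr rfl⟩
  have key : S ≤ (AlgHom.equalizer f g).map S.val := by
    conv_lhs => rw [hS]
    refine Algebra.adjoin_le ?_
    rintro b ⟨i, hi, rfl | rfl⟩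
    · exact ⟨⟨y i, hy i hi⟩, h i hi _, rfl⟩
    · let u : Sˣ := ⟨⟨_, hy i hi⟩, ⟨_, hy' i hi⟩, Subtype.ext (y i).mul_inv,
        Subtype.ext (y i).inv_mul⟩
      have hu : Units.map (f : S →* A) u = Units.map (g : S →* A) u := Units.ext (h i hi _)
      exact ⟨_, congrArg (fun v : Aˣ => ((v⁻¹ : Aˣ) : A)) hu, rfl⟩
  ext s
  obtain ⟨t, ht, hts⟩ := key s.2
  rwa [← Subtype.ext hts]

/-- Let `R` be an integral domain, `1 ≤ d`, `B = R[x₁^{±1}, …, x_d^{±1}, x_{d+1}, …, xₙ]`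
(with `n = d + m`), `φ` an idempotent `R`-algebra endomorphism of `B` and `A = φ(B)`.
Suppose `y₁, …, y_d ∈ B^*` satisfy `B = R[y₁^{±1}, …, y_d^{±1}, x_{d+1}, …, xₙ]`,
`φ(yᵢ) = yᵢ` for `i ≤ r`, `φ(yᵢ) = 1` for `i > r`; set `S = R[y₁^{±1}, …, y_r^{±1}]` and
`J = (y_{r+1} − 1, …, y_d − 1)B`.  Then the quotient map `π : B → B/J` is injective on `A`,
its image `C = π(A)` is an `S`-retract of `B/J`, and `B/J ≅ S^{[n−d]}` as `S`-algebras;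
hence `A` is `S`-algebra isomorphic to an `S`-retract of `S^{[n−d]}`. -/
theorem retract_modulo_J (R : Type*) [CommRing R] [IsDomain R] (d m : ℕ) (hd : 1 ≤ d)
    (φ : MixedLaurent R d m →ₐ[R] MixedLaurent R d m) (hφ : φ.comp φ = φ)
    (r : ℕ) (y : Fin d → (MixedLaurent R d m)ˣ)
    (hy : ∃ ψ : MixedLaurent R d m ≃ₐ[R] MixedLaurent R d m,
        (∀ i : Fin d, ψ (lVar R d m i) = (y i : MixedLaurent R d m)) ∧
        (∀ j : Fin m, ψ (pVar R d m j) = pVar R d m j))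
    (hy1 : ∀ i : Fin d, (i : ℕ) < r → φ ((y i : MixedLaurent R d m)) = (y i : MixedLaurent R d m))
    (hy2 : ∀ i : Fin d, r ≤ (i : ℕ) → φ ((y i : MixedLaurent R d m)) = 1)
    (S : Subalgebra R (MixedLaurent R d m))
    (hS : S = Algebra.adjoin R
      {b : MixedLaurent R d m | ∃ i : Fin d, (i : ℕ) < r ∧
        (b = (y i : MixedLaurent R d m) ∨ b = ((y i)⁻¹ : (MixedLaurent R d m)ˣ))})
    (J : Ideal (MixedLaurent R d m))
    (hJ : J = Ideal.span
      {b : MixedLaurent R d m | ∃ i : Fin d, r ≤ (i : ℕ) ∧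
        b = (y i : MixedLaurent R d m) - 1}) :
    Set.InjOn (Ideal.Quotient.mk J) (φ.range : Set (MixedLaurent R d m)) ∧
    (∃ ρ : (MixedLaurent R d m ⧸ J) →ₐ[S] (MixedLaurent R d m ⧸ J),
        ρ.comp ρ = ρ ∧
        (ρ.range : Set (MixedLaurent R d m ⧸ J)) =
          (Ideal.Quotient.mk J) '' (φ.range : Set (MixedLaurent R d m))) ∧
    Nonempty ((MixedLaurent R d m ⧸ J) ≃ₐ[S] MvPolynomial (Fin m) S) := by
  obtain ⟨ψ, hψl, hψp⟩ := hy
  have hφφ (b) : φ (φ b) = φ b := DFunLike.congr_fun hφ b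
  have hyS (i : Fin d) (hi : (i : ℕ) < r) : (y i : MixedLaurent R d m) ∈ S :=
    hS ▸ Algebra.subset_adjoin ⟨i, hi, Or.inl rfl⟩
  have hyS' (i : Fin d) (hi : (i : ℕ) < r) :
      (((y i)⁻¹ : (MixedLaurent R d m)ˣ) : MixedLaurent R d m) ∈ S :=
    hS ▸ Algebra.subset_adjoin ⟨i, hi, Or.inr rfl⟩
  have hφS (s : S) : φ s = s :=
    DFunLike.congr_fun (Subalgebra.algHom_ext_of_adjoin_units hS (f := φ.comp S.val) (g := S.val)
      fun i hi _ => hy1 i hi) s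
  have hφJ : ∀ b ∈ J, φ b = 0 := by
    have : J ≤ RingHom.ker φ := by
      rw [hJ, Ideal.span_le]
      rintro b ⟨i, hi, rfl⟩
      simp [RingHom.mem_ker, hy2 i hi]
    exact this
  refine ⟨?_, ?_, ?_⟩
  · rintro _ ⟨a, rfl⟩ _ ⟨b, rfl⟩ hab
    have := hφJ _ (Ideal.Quotient.eq.mp hab)
    rw [map_sub, sub_eq_zero] at this
    exact (hφφ a).symm.trans (this.trans (hφφ b))
  · let φS : MixedLaurent R d m →ₐ[S] MixedLaurent R d m :=
      { (φ : MixedLaurent R d m →+* MixedLaurent R d m) with commutes' := hφS }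
    let ρ : (MixedLaurent R d m ⧸ J) →ₐ[S] (MixedLaurent R d m ⧸ J) :=
      (Ideal.Quotient.mkₐ S J).comp (Ideal.Quotient.liftₐ J φS hφJ)
    have hρ (b) : ρ (Ideal.Quotient.mk J b) = Ideal.Quotient.mk J (φ b) := rfl
    refine ⟨ρ, ?_, ?_⟩
    · ext x
      obtain ⟨b, rfl⟩ := Ideal.Quotient.mk_surjective x
      simp only [AlgHom.comp_apply, hρ, hφφ]
    · ext x
      constructor
      · rintro ⟨z, rfl⟩
        obtain ⟨b, rfl⟩ := Ideal.Quotient.mk_surjective z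
        exact ⟨φ b, ⟨b, rfl⟩, rfl⟩
      · rintro ⟨_, ⟨b, rfl⟩, rfl⟩
        exact ⟨Ideal.Quotient.mk J b, rfl⟩
  · let yS (i : Fin d) : Sˣ :=
      if hi : (i : ℕ) < r then
        ⟨⟨_, hyS i hi⟩, ⟨_, hyS' i hi⟩, Subtype.ext (y i).mul_inv, Subtype.ext (y i).inv_mul⟩
      else 1
    have yS_lt (i : Fin d) (hi : (i : ℕ) < r) : ((yS i : S) : MixedLaurent R d m) = y i := by
      simp [yS, hi]
    have yS_ge (i : Fin d) (hi : r ≤ (i : ℕ)) : yS i = 1 := by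
      simp [yS, hi.not_gt]
    let F : MixedLaurent R d m →ₐ[R] MvPolynomial (Fin m) S :=
      (MixedLaurent.lift (A := MvPolynomial (Fin m) S) (fun i => Units.map (MvPolynomial.C : S →+* _).toMonoidHom (yS i))
        MvPolynomial.X).comp ψ.symm.toAlgHom
    have hFl (i : Fin d) : F (y i) = MvPolynomial.C (yS i : S) := by
      simp [F, ← hψl]
    have hFp (j : Fin m) : F (pVar R d m j) = MvPolynomial.X j := by
      have : ψ.symm (pVar R d m j) = pVar R d m j := by rw [AlgEquiv.symm_apply_eq, hψp]
      simp [F, this]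
    have hFS (s : S) : F s = MvPolynomial.C s := by
      refine DFunLike.congr_fun (Subalgebra.algHom_ext_of_adjoin_units hS (f := F.comp S.val)
        (g := IsScalarTower.toAlgHom R S _) fun i hi hi' => ?_) s
      exact (hFl i).trans (congrArg MvPolynomial.C (Subtype.ext (yS_lt i hi)))
    have hFJ : ∀ b ∈ J, F b = 0 := by
      have : J ≤ RingHom.ker F := by
        rw [hJ, Ideal.span_le]
        rintro b ⟨i, hi, rfl⟩
        simp [RingHom.mem_ker, hFl, yS_ge i hi]
      exact this
    let FS : MixedLaurent R d m →ₐ[S] MvPolynomial (Fin m) S :=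
      { (F : MixedLaurent R d m →+* MvPolynomial (Fin m) S) with commutes' := hFS }
    let G : MvPolynomial (Fin m) S →ₐ[S] MixedLaurent R d m ⧸ J :=
      MvPolynomial.aeval fun j => Ideal.Quotient.mk J (pVar R d m j)
    have hGF : ((G.restrictScalars R).comp F).comp ψ.toAlgHom =
        (Ideal.Quotient.mkₐ R J).comp ψ.toAlgHom := by
      refine MixedLaurent.algHom_ext (fun i => ?_) (fun j => ?_)
      · suffices G (F (ψ (lVar R d m i))) = Ideal.Quotient.mk J (ψ (lVar R d m i)) from this
        rw [hψl, hFl, MvPolynomial.algHom_C]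
        rcases lt_or_ge (i : ℕ) r with hi | hi
        · exact congrArg (Ideal.Quotient.mk J) (yS_lt i hi)
        · rw [yS_ge i hi, Units.val_one, map_one, eq_comm, ← map_one (Ideal.Quotient.mk J),
            Ideal.Quotient.eq, hJ]
          exact Ideal.subset_span ⟨i, hi, rfl⟩
      · suffices G (F (ψ (pVar R d m j))) = Ideal.Quotient.mk J (ψ (pVar R d m j)) from this
        rw [hψp, hFp, MvPolynomial.aeval_X]
    refine ⟨AlgEquiv.ofAlgHom (Ideal.Quotient.liftₐ J FS hFJ) G ?_ ?_⟩
    · refine MvPolynomial.algHom_ext fun j => ?_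
      rw [AlgHom.comp_apply, MvPolynomial.aeval_X]
      exact hFp j
    · ext x
      obtain ⟨b, rfl⟩ := Ideal.Quotient.mk_surjective x
      obtain ⟨c, rfl⟩ := ψ.surjective b
      exact DFunLike.congr_fun hGF c
end

section
/- Let R be an integral domain, 1 ≤ d ≤ n, B = R[x₁^{±1}, …, x_d^{±1}, x_{d+1}, …, xₙ], φ : B → B an R-algebra homomorphism with φ ∘ φ = φ, A = φ(B), and r the rank of U_R(A) = A^*/R^*. If tr.deg_R A = r, then A is R-algebra isomorphic to the Laurent polynomial ring R^{[±r]} = R[y₁^{±1}, …, y_r^{±1}]. -/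
/-- Infinitely many ring homomorphisms to a domain that agree on `K` cannot separate an element
algebraic over `K`: its images are roots of one nonzero polynomial. -/
theorem exists_ne_map_eq_of_isAlgebraic {K A B : Type*} [CommRing K] [CommRing A] [CommRing B]
    [IsDomain B] [Algebra K A] (ψ : ℕ → A →+* B)
    (hψ : ∀ k c, ψ k (algebraMap K A c) = ψ 0 (algebraMap K A c))
    (hinj : Function.Injective fun c => ψ 0 (algebraMap K A c)) {a : A} (ha : IsAlgebraic K a) :
    ∃ k l, k ≠ l ∧ ψ k a = ψ l a := by
  classical
  obtain ⟨p, hp, hpa⟩ := ha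
  let ρ : K →+* B := (ψ 0).comp (algebraMap K A)
  have hp' : p.map ρ ≠ 0 := (Polynomial.map_ne_zero_iff hinj).2 hp
  have hroot (k : ℕ) : ψ k a ∈ (p.map ρ).roots.toFinset := by
    have hρ : (ψ k).comp (algebraMap K A) = ρ := RingHom.ext (hψ k)
    rw [Multiset.mem_toFinset, Polynomial.mem_roots hp', Polynomial.IsRoot, Polynomial.eval_map,
      ← hρ, ← Polynomial.hom_eval₂, ← Polynomial.aeval_def, hpa, map_zero]
  obtain ⟨k, l, hkl, h⟩ := Finite.exists_ne_map_eq_of_infinite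
    fun k => (⟨ψ k a, hroot k⟩ : (p.map ρ).roots.toFinset)
  exact ⟨k, l, hkl, congrArg Subtype.val h⟩

namespace AddMonoidAlgebra

/-- Elements algebraic over a ring of elements supported in `ker q` are supported in `ker q`. -/
theorem map_eq_zero_of_mem_support_of_isAlgebraic {R G N K A : Type*} [CommRing R] [IsDomain R]
    [AddCommMonoid G] [AddCancelCommMonoid N] [IsAddTorsionFree N] [UniqueSums (G × N)]
    [CommRing K] [CommRing A] [Algebra K A] [FaithfulSMul K A] (q : G →+ N)
    {i : A →+* AddMonoidAlgebra R G} (hi : Function.Injective i)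
    (hK : ∀ c : K, ∀ g ∈ (i (algebraMap K A c)).coeff.support, q g = 0)
    {a : A} (ha : IsAlgebraic K a) {g : G} (hg : g ∈ (i a).coeff.support) :
    q g = 0 := by
  classical
  let θ (k : ℕ) : G →+ G × N := (AddMonoidHom.id G).prod (k • q)
  have hθ (k : ℕ) : Function.Injective (θ k) := fun x y h => congrArg Prod.fst h
  obtain ⟨k, l, hkl, h⟩ := exists_ne_map_eq_of_isAlgebraic
    (fun k => (mapDomainAlgHom R R (θ k)).toRingHom.comp i)
    (fun k c => by
      show mapDomain (θ k) _ = mapDomain (θ 0) _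
      refine coeff_injective (Finsupp.mapDomain_congr fun g hg => ?_)
      simp [θ, hK c g hg])
    ((mapDomain_injective (hθ 0)).comp (hi.comp (FaithfulSMul.algebraMap_injective K A))) ha
  replace h : mapDomain (θ k) (i a) = mapDomain (θ l) (i a) := h
  have hmem : θ k g ∈ (mapDomain (θ l) (i a)).coeff.support := by
    rw [← h]
    show θ k g ∈ (Finsupp.mapDomain _ _).support
    rw [Finsupp.mem_support_iff, Finsupp.mapDomain_apply (hθ k)]
    exact Finsupp.mem_support_iff.1 hg
  obtain ⟨g', -, hg'⟩ := Finset.mem_image.1 (Finsupp.mapDomain_support hmem)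
  obtain rfl : g' = g := congrArg Prod.fst hg'
  have : l • q g' = k • q g' := congrArg Prod.snd hg'
  by_contra h0
  exact hkl (injective_nsmul_iff_not_isOfFinAddOrder.2
    (not_isOfFinAddOrder_of_isAddTorsionFree h0) this).symm

theorem exists_eq_single_of_isUnit_s12 {R G : Type*} [CommRing R] [IsDomain R] [AddCommMonoid G]
    [TwoUniqueSums G] {a : AddMonoidAlgebra R G} (ha : IsUnit a) :
    ∃ g c, IsAddUnit g ∧ IsUnit c ∧ a = single g c := by
  classical
  obtain ⟨b, hab⟩ := ha.exists_right_inv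
  have ha0 : a ≠ 0 := ha.ne_zero
  have hb0 : b ≠ 0 := right_ne_zero_of_mul_eq_one hab
  have hcard : a.coeff.support.card * b.coeff.support.card ≤ 1 := by
    by_contra! hlt
    obtain ⟨p, hp, p', hp', hne, hu, hu'⟩ := TwoUniqueSums.uniqueAdd_of_one_lt_card hlt
    have key (p : G × G) (hp : p ∈ a.coeff.support ×ˢ b.coeff.support)
        (hu : UniqueAdd a.coeff.support b.coeff.support p.1 p.2) : p.1 + p.2 = 0 := by
      have h := coeff_mul_add_of_uniqueAdd hu
      rw [Finset.mem_product, Finsupp.mem_support_iff, Finsupp.mem_support_iff] at hp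
      by_contra h0
      rw [hab, one_def, coeff_single, Finsupp.single_apply, if_neg (Ne.symm h0)] at h
      exact mul_ne_zero hp.1 hp.2 h.symm
    have hp2 := Finset.mem_product.1 hp'
    have := hu hp2.1 hp2.2 ((key p' hp' hu').trans (key p hp hu).symm)
    exact hne (Prod.ext this.1.symm this.2.symm)
  have hpos (x : AddMonoidAlgebra R G) (hx : x ≠ 0) : 0 < x.coeff.support.card :=
    Finset.card_pos.2 (Finsupp.support_nonempty_iff.2 (coeff_eq_zero.not.2 hx))
  have hsingle (x : AddMonoidAlgebra R G) (hx : x.coeff.support.card = 1) :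
      ∃ g c, x = single g c := by
    obtain ⟨g, c, -, h⟩ := Finsupp.card_support_eq_one'.1 hx
    exact ⟨g, c, coeff_injective h⟩
  obtain ⟨g, c, rfl⟩ := hsingle a (by nlinarith [hpos a ha0, hpos b hb0])
  obtain ⟨h, e, rfl⟩ := hsingle b (by nlinarith [hpos _ ha0, hpos b hb0])
  rw [single_mul_single, one_def, single_inj] at hab
  obtain ⟨h1, h2⟩ | ⟨-, h2⟩ := hab
  · exact ⟨g, c, .of_add_eq_zero h h1, .of_mul_eq_one e h2, rfl⟩
  · exact absurd h2 one_ne_zero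

theorem algebraicIndependent_single {R G ι : Type*} [CommRing R] [AddCommMonoid G]
    (g : ι → G) (hg : Function.Injective fun n : ι →₀ ℕ => n.sum fun i k => k • g i) :
    AlgebraicIndependent R fun i => (single (g i) 1 : AddMonoidAlgebra R G) := by
  let θ : (ι →₀ ℕ) →+ G := Finsupp.liftAddHom fun i => (multiplesHom G) (g i)
  have h : MvPolynomial.aeval (fun i => (single (g i) 1 : AddMonoidAlgebra R G)) =
      mapDomainAlgHom R R θ := by
    refine MvPolynomial.algHom_ext (A := AddMonoidAlgebra R G) fun i => ?_
    rw [MvPolynomial.aeval_X]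
    refine Eq.trans ?_ (mapDomain_single (f := θ)).symm
    simp [θ]
  show Function.Injective _
  rw [h]
  exact mapDomain_injective (f := θ) hg

end AddMonoidAlgebra

namespace AddMonoidAlgebra

theorem mem_range_mapDomainAlgHom_iff {R M N : Type*} [CommRing R] [AddMonoid M] [AddMonoid N]
    {f : M →+ N} (hf : Function.Injective f) {x : AddMonoidAlgebra R N} :
    x ∈ (mapDomainAlgHom R R f).range ↔ ∀ n ∈ x.coeff.support, n ∈ Set.range f := by
  classical
  refine ⟨?_, fun h => ⟨_, mapDomain_comapDomain (f := f) h hf⟩⟩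
  rintro ⟨y, rfl⟩ n hn
  obtain ⟨m, -, hm⟩ := Finset.mem_image.1 (Finsupp.mapDomain_support hn)
  exact ⟨m, hm⟩

theorem mem_range_mapDomainAlgHom_of_isAlgebraic {R M G N A : Type*} [CommRing R] [IsDomain R]
    [AddCommMonoid M] [AddCommMonoid G] [AddCancelCommMonoid N] [IsAddTorsionFree N]
    [UniqueSums (G × N)] [CommRing A] [Algebra R A] {f : M →+ G} (hf : Function.Injective f)
    {q : G →+ N} (hq : ∀ g, q g = 0 ↔ g ∈ Set.range f) {i : A →ₐ[R] AddMonoidAlgebra R G}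
    (hi : Function.Injective i) {s : Set A} (hs : ∀ a ∈ s, i a ∈ (mapDomainAlgHom R R f).range)
    {a : A} (ha : IsAlgebraic (Algebra.adjoin R s) a) : i a ∈ (mapDomainAlgHom R R f).range := by
  have hle : Algebra.adjoin R s ≤ (mapDomainAlgHom R R f).range.comap i := Algebra.adjoin_le hs
  refine (mem_range_mapDomainAlgHom_iff hf).2 fun g hg => (hq g).1 ?_
  exact map_eq_zero_of_mem_support_of_isAlgebraic (i := i.toRingHom) q hi
    (fun c g hg => (hq g).2 ((mem_range_mapDomainAlgHom_iff hf).1 (hle c.2) g hg)) ha hg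

theorem range_mapDomainAlgHom_le {R M G : Type*} [CommRing R] [AddMonoid M] [AddMonoid G]
    {f : M →+ G} {A : Subalgebra R (AddMonoidAlgebra R G)} (h : ∀ v, single (f v) 1 ∈ A) :
    (mapDomainAlgHom R R f).range ≤ A := by
  rintro _ ⟨y, rfl⟩
  show mapDomainAlgHom R R f y ∈ A
  induction y using AddMonoidAlgebra.induction_on with
  | of v =>
    have hv : mapDomainAlgHom R R f (single v 1) = single (f v) 1 := mapDomain_single (f := f)
    exact hv.symm ▸ h v
  | add y z hy hz => rw [map_add]; exact add_mem hy hz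
  | smul c y hy => rw [map_smul]; exact A.smul_mem hy c

end AddMonoidAlgebra

theorem groupRank_eq_of_bijective {G : Type*} [CommGroup G] {L : Type} [AddCommGroup L]
    [Module.Free ℤ L] [Module.Finite ℤ L] (w : Multiplicative L →* G)
    (hw : Function.Bijective w) : groupRank G = Module.finrank ℤ L := by
  let e : L ≃+ Additive G := AddEquiv.ofBijective (MonoidHom.toAdditiveRight w) hw
  have h := e.toIntLinearEquiv.lift_rank_eq
  rw [groupRank, ← Cardinal.lift_inj, ← h, ← Module.finrank_eq_rank]
  simp

open AddMonoidAlgebra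

namespace MixedLaurent

variable {R : Type*} [CommRing R] {d m : ℕ}

/-- The Laurent monomials with coefficient `1`, as a monoid homomorphism. -/
noncomputable def monomial (R : Type*) [CommRing R] (d m : ℕ) :
    Multiplicative (Fin d → ℤ) →* MixedLaurent R d m :=
  (AddMonoidAlgebra.of R _).comp
    (AddMonoidHom.toMultiplicative (AddMonoidHom.inl (Fin d → ℤ) (Fin m → ℕ)))

theorem monomial_apply (g : Fin d → ℤ) :
    monomial R d m (.ofAdd g) = single (g, 0) 1 := rfl

theorem smul_monomial (c : R) (g : Fin d → ℤ) :
    c • monomial R d m (.ofAdd g) = single (g, 0) c := by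
  simp [monomial_apply]

theorem eq_and_eq_of_smul_monomial_eq {c c' : R} (hc : c ≠ 0) {g g' : Fin d → ℤ}
    (h : c • monomial R d m (.ofAdd g) = c' • monomial R d m (.ofAdd g')) : g = g' ∧ c = c' := by
  rw [smul_monomial, smul_monomial, single_inj] at h
  obtain ⟨h1, h2⟩ | h := h
  · exact ⟨congrArg Prod.fst h1, h2⟩
  · exact absurd h.1 hc

theorem exists_eq_smul_monomial_of_isUnit [IsDomain R] {a : MixedLaurent R d m} (ha : IsUnit a) :
    ∃ (g : Fin d → ℤ) (c : Rˣ), a = c • monomial R d m (.ofAdd g) := by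
  obtain ⟨⟨g, h⟩, c, hg, hc, rfl⟩ := exists_eq_single_of_isUnit_s12 ha
  obtain ⟨v, hv⟩ := hg.exists_neg
  have h0 : h = 0 := by
    funext i
    have := congrFun (congrArg Prod.snd hv) i
    simp at this
    exact this.1
  subst h0
  exact ⟨g, hc.unit, (smul_monomial c g).symm⟩

theorem isUnit_monomial (g : Multiplicative (Fin d → ℤ)) : IsUnit (monomial R d m g) :=
  (Group.isUnit g).map _

/-- An endomorphism of the mixed Laurent ring acts on Laurent monomials, up to unit scalars,
through an endomorphism of the exponent group. -/
theorem exists_exponentHom [IsDomain R] (φ : MixedLaurent R d m →ₐ[R] MixedLaurent R d m) :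
    ∃ π : (Fin d → ℤ) →+ (Fin d → ℤ), ∀ g, ∃ c : Rˣ,
      φ (monomial R d m (.ofAdd g)) = c • monomial R d m (.ofAdd (π g)) := by
  choose π c h using fun g : Fin d → ℤ =>
    exists_eq_smul_monomial_of_isUnit ((isUnit_monomial (R := R) (m := m) (.ofAdd g)).map φ)
  refine ⟨AddMonoidHom.mk' π fun a b => ?_, fun g => ⟨c g, h g⟩⟩
  have key : ((c (a + b) : Rˣ) : R) • monomial R d m (.ofAdd (π (a + b))) =
      ((c a : R) * (c b : R)) • monomial R d m (.ofAdd (π a + π b)) := by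
    have := h (a + b)
    rw [ofAdd_add, map_mul, map_mul, h a, h b] at this
    rw [ofAdd_add, map_mul, ← smul_mul_smul_comm]
    exact this.symm
  exact (eq_and_eq_of_smul_monomial_eq (c (a + b)).ne_zero key).1

/-- An idempotent endomorphism acts on exponents of Laurent monomials through a retraction onto
the exponents of the monomials in its range. -/
theorem exists_retraction [IsDomain R] (φ : MixedLaurent R d m →ₐ[R] MixedLaurent R d m)
    (hφ : φ.comp φ = φ) :
    ∃ π : (Fin d → ℤ) →+ (Fin d → ℤ), (∀ g, π (π g) = π g) ∧
      ∀ g, monomial R d m (.ofAdd g) ∈ φ.range ↔ π g = g := by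
  obtain ⟨π, hπ⟩ := exists_exponentHom φ
  have hmem (g) : monomial R d m (.ofAdd (π g)) ∈ φ.range := by
    obtain ⟨c, hc⟩ := hπ g
    rw [← inv_smul_eq_iff] at hc
    rw [← hc]
    exact φ.range.smul_mem ⟨_, rfl⟩ ((c⁻¹ : Rˣ) : R)
  have hfix (g) (hg : monomial R d m (.ofAdd g) ∈ φ.range) : π g = g := by
    obtain ⟨y, hy⟩ := hg
    obtain ⟨c, hc⟩ := hπ g
    have hy' : φ y = monomial R d m (.ofAdd g) := hy
    rw [← hy', ← AlgHom.comp_apply, hφ, hy'] at hc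
    refine (eq_and_eq_of_smul_monomial_eq (m := m) (c := (1 : R)) (c' := c) one_ne_zero ?_).1.symm
    rw [one_smul]
    exact hc
  exact ⟨π, fun g => hfix _ (hmem g), fun g => ⟨hfix g, fun h => h ▸ hmem g⟩⟩

/-- If the Laurent monomials in a subalgebra `A` are those with exponent in `L`, then
`rank U_R(A) = rank L`. -/
theorem groupRank_urGroup_eq [IsDomain R] (A : Subalgebra R (MixedLaurent R d m))
    (L : Submodule ℤ (Fin d → ℤ)) (hL : ∀ g, monomial R d m (.ofAdd g) ∈ A ↔ g ∈ L) :
    groupRank (URGroup R A) = Module.finrank ℤ L := by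
  let t : Multiplicative L →* A :=
    ((monomial R d m).comp (AddMonoidHom.toMultiplicative L.subtype.toAddMonoidHom)).codRestrict A
      fun l => (hL _).2 l.toAdd.2
  refine groupRank_eq_of_bijective ((QuotientGroup.mk' _).comp t.toHomUnits) ⟨?_, ?_⟩
  · rw [injective_iff_map_eq_one]
    intro l hl
    obtain ⟨c, hc⟩ := (QuotientGroup.eq_one_iff _).1 hl
    have hc' : algebraMap R (MixedLaurent R d m) c =
        monomial R d m (.ofAdd (l.toAdd : Fin d → ℤ)) :=
      congrArg (fun u : Aˣ => ((u : A) : MixedLaurent R d m)) hc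
    have h := eq_and_eq_of_smul_monomial_eq (m := m) (c := (c : R)) (c' := 1)
      (g := (0 : Fin d → ℤ)) (g' := (l.toAdd : Fin d → ℤ)) c.ne_zero (by
        rw [one_smul, ← hc', ofAdd_zero, map_one, Algebra.algebraMap_eq_smul_one])
    exact Subtype.ext h.1.symm
  · intro x
    obtain ⟨u, rfl⟩ := QuotientGroup.mk_surjective x
    obtain ⟨g, c, hg⟩ := exists_eq_smul_monomial_of_isUnit (u.isUnit.map A.val)
    have hgL : g ∈ L := by
      rw [← hL]
      rw [← inv_smul_eq_iff] at hg
      rw [← hg]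
      exact A.smul_mem u.1.2 ((c⁻¹ : Rˣ) : R)
    refine ⟨.ofAdd ⟨g, hgL⟩, QuotientGroup.eq.2 ⟨c, ?_⟩⟩
    rw [eq_inv_mul_iff_mul_eq]
    refine Units.ext (Subtype.ext (Eq.trans ?_ hg.symm))
    show monomial R d m (.ofAdd g) * algebraMap R _ (c : R) = (c : R) • _
    rw [mul_comm, Algebra.smul_def]

end MixedLaurent

open MixedLaurent

/-- Let `R` be an integral domain, `1 ≤ d`, `B = R[x₁^{±1}, …, x_d^{±1}, x_{d+1}, …, xₙ]`
(with `n = d + m`), `φ` an idempotent `R`-algebra endomorphism of `B`, `A = φ(B)` and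
`r = rank U_R(A)`.  If `tr.deg_R A = r` then `A` is `R`-algebra isomorphic to the Laurent
polynomial ring `R^{[±r]}`. -/
theorem retract_isLaurent_of_trdeg_eq_rank (R : Type*) [CommRing R] [IsDomain R] (d m : ℕ)
    (hd : 1 ≤ d)
    (φ : MixedLaurent R d m →ₐ[R] MixedLaurent R d m) (hφ : φ.comp φ = φ)
    (r : ℕ) (hr : groupRank (URGroup R φ.range) = (r : Cardinal))
    (htr : trdeg R φ.range = (r : Cardinal)) :
    Nonempty (φ.range ≃ₐ[R] AddMonoidAlgebra R (Fin r → ℤ)) := by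
  obtain ⟨π, hππ, hπ⟩ := exists_retraction φ hφ
  let L : Submodule ℤ (Fin d → ℤ) := LinearMap.range π.toIntLinearMap
  have hL (g) : g ∈ L ↔ π g = g :=
    ⟨by rintro ⟨x, rfl⟩; exact hππ x, fun h => ⟨g, h⟩⟩
  have hrank : Module.finrank ℤ L = r := by
    have := groupRank_urGroup_eq φ.range L fun g => (hπ g).trans (hL g).symm
    exact_mod_cast this.symm.trans hr
  let b := Module.finBasisOfFinrankEq ℤ L hrank
  let e : (Fin r → ℤ) →+ (Fin d → ℤ) :=
    (L.subtype.comp b.equivFun.symm.toLinearMap).toAddMonoidHom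
  have he : Function.Injective e := L.subtype_injective.comp b.equivFun.symm.injective
  have heL (g) : g ∈ Set.range e ↔ π g = g := by
    rw [← hL]
    exact ⟨by rintro ⟨x, rfl⟩; exact (b.equivFun.symm x).2,
      fun h => ⟨b.equivFun ⟨g, h⟩, by simp [e]⟩⟩
  let ι : (Fin r → ℤ) →+ (Fin d → ℤ) × (Fin m → ℕ) := (AddMonoidHom.inl _ _).comp e
  have hι : Function.Injective ι := fun x y h => he (congrArg Prod.fst h)
  let f := mapDomainAlgHom R R ι
  have hf : Function.Injective f := mapDomain_injective (f := ι) hι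
  have hf1 (v : Fin r → ℤ) : f (single v 1) = monomial R d m (.ofAdd (e v)) :=
    mapDomain_single (f := ι)
  have hfA (v : Fin r → ℤ) : f (single v 1) ∈ φ.range := by
    rw [hf1, hπ, ← heL]
    exact ⟨v, rfl⟩
  let x (i : Fin r) : φ.range := ⟨f (single (Pi.single i 1) 1), hfA _⟩
  have hx : AlgebraicIndependent R x := by
    refine AlgebraicIndependent.of_comp φ.range.val ?_
    refine (algebraicIndependent_single (R := R) (fun i : Fin r => (Pi.single i 1 : Fin r → ℤ))
      fun p q hpq => ?_).map' (f := f) hf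
    ext i
    have := congrFun hpq i
    simpa [Finsupp.sum_fintype, Finset.sum_apply, Pi.single_apply] using this
  have hbasis : IsTranscendenceBasis R x := by
    refine hx.isTranscendenceBasis_of_lift_trdeg_le_of_finite ?_
    have : Algebra.trdeg R φ.range = r := htr
    simp [this]
  let q : (Fin d → ℤ) × (Fin m → ℕ) →+ (Fin d → ℤ) × (Fin m → ℕ) :=
    ((AddMonoidHom.id _ - π).comp (AddMonoidHom.fst _ _)).prod (AddMonoidHom.snd _ _)
  have hq (g) : q g = 0 ↔ g ∈ Set.range ι := by
    obtain ⟨g, h⟩ := g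
    have : (g, h) ∈ Set.range ι ↔ g ∈ Set.range e ∧ h = 0 := by
      simp [ι, eq_comm, ← exists_and_right]
    rw [this, heL]
    simp [q, sub_eq_zero, eq_comm (a := g)]
  have hrange : φ.range = f.range := by
    refine le_antisymm (fun a ha => mem_range_mapDomainAlgHom_of_isAlgebraic hι hq
      (i := φ.range.val) Subtype.val_injective (s := Set.range x) ?_
      (hbasis.isAlgebraic.isAlgebraic ⟨a, ha⟩)) (range_mapDomainAlgHom_le fun v => ?_)
    · rintro _ ⟨i, rfl⟩
      exact ⟨_, rfl⟩
    · exact (hπ _).2 ((heL _).1 ⟨v, rfl⟩)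
  exact ⟨(Subalgebra.equivOfEq _ _ hrange).trans (AlgEquiv.ofInjective f hf).symm⟩
end

section
/- Let R be an integral domain, 1 ≤ d ≤ n with d ≥ n − 1, B = R[x₁^{±1}, …, x_d^{±1}, x_{d+1}, …, xₙ], φ : B → B an R-algebra homomorphism with φ ∘ φ = φ, A = φ(B), and r the rank of U_R(A) = A^*/R^*. Then A is R-algebra isomorphic to R^{[±r]} ⊗_R R^{[s]} = R[y₁^{±1}, …, y_r^{±1}, z₁, …, z_s] for some s ∈ {0, 1}. -/
theorem groupRank_eq_of_mulEquiv {G : Type*} [CommGroup G] {r : ℕ}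
    (e : Multiplicative (Fin r → ℤ) ≃* G) : groupRank G = r := by
  let f : (Fin r → ℤ) ≃+ Additive G := MulEquiv.toAdditiveRight e
  have := rank_eq_card_basis (Module.Basis.ofEquivFun f.symm.toIntLinearEquiv)
  rw [Fintype.card_fin] at this
  exact this

namespace AddMonoidAlgebra

/-- A unit of a monoid algebra over a domain is a monomial when the exponents have the two unique
sums property. -/
theorem exists_eq_single_of_mul_eq_one {R G : Type*} [CommRing R] [IsDomain R] [AddMonoid G]
    [TwoUniqueSums G] {u v : AddMonoidAlgebra R G} (h : u * v = 1) :
    ∃ (a b : G) (r s : R), a + b = 0 ∧ r * s = 1 ∧ u = single a r ∧ v = single b s := by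
  classical
  have hu : u ≠ 0 := by rintro rfl; simp at h
  have hv : v ≠ 0 := by rintro rfl; simp at h
  have hu' : u.coeff.support.Nonempty := by
    rw [Finsupp.support_nonempty_iff]; simpa using hu
  have hv' : v.coeff.support.Nonempty := by
    rw [Finsupp.support_nonempty_iff]; simpa using hv
  have hsum : ∀ p ∈ u.coeff.support ×ˢ v.coeff.support,
      UniqueAdd u.coeff.support v.coeff.support p.1 p.2 → p.1 + p.2 = 0 := by
    intro p hp hpu
    have h1 := coeff_mul_add_of_uniqueAdd hpu
    rw [h] at h1
    by_contra hne
    rw [one_def, coeff_single, Finsupp.single_eq_of_ne hne] at h1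
    rw [Finset.mem_product, Finsupp.mem_support_iff, Finsupp.mem_support_iff] at hp
    exact mul_ne_zero hp.1 hp.2 h1.symm
  have hcard : ¬ 1 < u.coeff.support.card * v.coeff.support.card := by
    intro hlt
    obtain ⟨p, hp, q, hq, hpq, hpu, hqu⟩ := TwoUniqueSums.uniqueAdd_of_one_lt_card hlt
    rw [Finset.mem_product] at hq
    have := hpu hq.1 hq.2 ((hsum q (Finset.mem_product.2 hq) hqu).trans (hsum p hp hpu).symm)
    exact hpq (Prod.ext this.1.symm this.2.symm)
  have hu1 := hu'.card_pos
  have hv1 := hv'.card_pos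
  have hu2 : u.coeff.support.card = 1 := by nlinarith
  have hv2 : v.coeff.support.card = 1 := by nlinarith
  obtain ⟨a, r, -, har⟩ := Finsupp.card_support_eq_one'.1 hu2
  obtain ⟨b, s, -, hbs⟩ := Finsupp.card_support_eq_one'.1 hv2
  have hua : u = single a r := by ext1; rw [har, coeff_single]
  have hvb : v = single b s := by ext1; rw [hbs, coeff_single]
  have hne : single (a + b) (r * s) = (single 0 1 : AddMonoidAlgebra R G) := by
    rw [← single_mul_single, ← hua, ← hvb, h, one_def]
  have hne' := congrArg coeff hne
  rw [coeff_single, coeff_single, Finsupp.single_eq_single_iff] at hne'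
  obtain ⟨hab, hrs⟩ | ⟨-, h0⟩ := hne'
  · exact ⟨a, b, r, s, hab, hrs, hua, hvb⟩
  · exact absurd h0 one_ne_zero

/-- The range of an idempotent endomorphism of the group algebra of a lattice is again the group
algebra of a lattice. -/
theorem exists_range_algEquiv_of_idempotent {R : Type*} [CommRing R] [IsDomain R] {d : ℕ}
    (ψ : AddMonoidAlgebra R (Fin d → ℤ) →ₐ[R] AddMonoidAlgebra R (Fin d → ℤ))
    (hψ : ψ.comp ψ = ψ) :
    ∃ r : ℕ, Nonempty (ψ.range ≃ₐ[R] AddMonoidAlgebra R (Fin r → ℤ)) := by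
  classical
  have hmono : ∀ a : Fin d → ℤ, ∃ (b : Fin d → ℤ) (t : R), t ≠ 0 ∧
      ψ (single a 1) = single b t := by
    intro a
    have h : ψ (single a 1) * ψ (single (-a) 1) = 1 := by
      rw [← map_mul, single_mul_single, add_neg_cancel, one_mul, ← one_def, map_one]
    obtain ⟨b, _, t, s, -, hts, hb, -⟩ := exists_eq_single_of_mul_eq_one h
    exact ⟨b, t, left_ne_zero_of_mul_eq_one hts, hb⟩
  choose π c hc hπ using hmono
  have inj : ∀ {a b : Fin d → ℤ} {s t : R}, s ≠ 0 → single a s = single b t → a = b ∧ s = t := by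
    intro a b s t hs h
    have h' := congrArg coeff h
    rw [coeff_single, coeff_single, Finsupp.single_eq_single_iff] at h'
    exact h'.resolve_right fun h0 => hs h0.1
  have hadd : ∀ a b, π (a + b) = π a + π b := by
    intro a b
    refine (inj (hc (a + b)) (t := c a * c b) ?_).1
    rw [← hπ, ← single_mul_single, ← hπ, ← hπ, ← map_mul, single_mul_single, one_mul]
  let πh : (Fin d → ℤ) →+ (Fin d → ℤ) := AddMonoidHom.mk' π hadd
  have hfix : ∀ a, ψ (single (π a) 1) = single (π a) 1 := by
    intro a
    have h1 : ψ (ψ (single a 1)) = ψ (single a 1) := DFunLike.congr_fun hψ _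
    have h2 : c a • ψ (single (π a) 1) = c a • single (π a) 1 := by
      rw [← map_smul, smul_single, smul_eq_mul, mul_one, ← hπ, h1]
    rw [hπ, smul_single, smul_single, smul_eq_mul, smul_eq_mul, mul_one] at h2
    obtain ⟨h3, h4⟩ := inj (mul_ne_zero (hc _) (hc _)) h2
    rw [hπ, h3, mul_left_cancel₀ (hc a) (h4.trans (mul_one _).symm)]
  let M : Submodule ℤ (Fin d → ℤ) := LinearMap.range πh.toIntLinearMap
  let ι : AddMonoidAlgebra R M →ₐ[R] AddMonoidAlgebra R (Fin d → ℤ) :=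
    mapDomainAlgHom R R M.subtype.toAddMonoidHom
  have hι : Function.Injective ι := mapDomain_injective M.injective_subtype
  have hrange : ι.range = ψ.range := by
    apply le_antisymm
    · have : ψ.comp ι = ι := by
        refine algHom_ext ?_ (Subsingleton.elim _ _)
        rintro ⟨_, a, rfl⟩
        simpa [ι, πh] using hfix a
      rintro _ ⟨x, rfl⟩
      exact ⟨ι x, DFunLike.congr_fun this x⟩
    · rintro _ ⟨x, rfl⟩
      change ψ x ∈ ι.range
      induction x using AddMonoidAlgebra.induction_linear with
      | zero => simp
      | add f g hf hg => rw [map_add]; exact add_mem hf hg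
      | single a t =>
        have : ψ (single a t) = ι (single ⟨π a, a, rfl⟩ (t * c a)) := by
          have : (single a t : AddMonoidAlgebra R (Fin d → ℤ)) = t • single a 1 := by
            rw [smul_single, smul_eq_mul, mul_one]
          rw [this, map_smul, hπ, smul_single, smul_eq_mul]
          simp [ι]
        exact ⟨_, this.symm⟩
  let e : M ≃+ (Fin (Module.finrank ℤ M) → ℤ) := (Module.finBasis ℤ M).equivFun.toAddEquiv
  exact ⟨_, ⟨(Subalgebra.equivOfEq _ _ hrange.symm).trans
    ((AlgEquiv.ofInjective ι hι).symm.trans (domCongr R R e))⟩⟩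

end AddMonoidAlgebra

namespace Polynomial

/-- A retraction of `D[X]` preserving the constants has range either the range `D'` of a retraction
of `D`, or `D'[X]`. -/
theorem exists_range_algEquiv_of_idempotent {R D : Type*} [CommRing R] [CommRing D] [IsDomain D]
    [Algebra R D] (φ : D[X] →ₐ[R] D[X]) (hφ : φ.comp φ = φ) (hD : ∀ a, ∃ b, φ (C a) = C b) :
    ∃ ψ : D →ₐ[R] D, ψ.comp ψ = ψ ∧
      (Nonempty (φ.range ≃ₐ[R] ψ.range) ∨ Nonempty (φ.range ≃ₐ[R] ψ.range[X])) := by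
  let ψ : D →ₐ[R] D := ((aeval (0 : D)).restrictScalars R).comp (φ.comp CAlgHom)
  have hC : ∀ a, φ (C a) = C (ψ a) := by
    intro a
    obtain ⟨b, hb⟩ := hD a
    simp [ψ, hb]
  have hφφ : ∀ p, φ (φ p) = φ p := DFunLike.congr_fun hφ
  have hψψ : ∀ a, ψ (ψ a) = ψ a := by
    intro a
    apply C_injective
    rw [← hC, ← hC, hφφ]
  have hψ : ∀ c : ψ.range, ψ c = c := by
    rintro ⟨_, a, rfl⟩
    exact hψψ a
  refine ⟨ψ, AlgHom.ext hψψ, ?_⟩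
  let j : ψ.range[X] →ₐ[R] D[X] := mapAlgHom ψ.range.val
  let ρ : D[X] →ₐ[R] ψ.range[X] := mapAlgHom ψ.rangeRestrict
  let σ : ψ.range[X] →ₐ[R] D[X] := φ.comp j
  have hσC : ∀ c : ψ.range, σ (C c) = C (c : D) := by
    intro c
    simp [σ, j, hC, hψ]
  have hσρ : σ.comp ρ = φ := by
    apply AlgHom.coe_ringHom_injective
    apply ringHom_ext
    · intro a
      have : ρ (C a) = C (ψ.rangeRestrict a) := by simp [ρ]
      change σ (ρ (C a)) = φ (C a)
      rw [this, hσC, hC]; rfl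
    · simp [σ, ρ, j]
  have hσρ' : ∀ p, σ (ρ p) = φ p := DFunLike.congr_fun hσρ
  have hrange : σ.range = φ.range := by
    apply le_antisymm
    · rintro _ ⟨p, rfl⟩
      exact ⟨j p, rfl⟩
    · rintro _ ⟨p, rfl⟩
      exact ⟨ρ p, hσρ' p⟩
  by_cases hinj : Function.Injective σ
  · exact .inr ⟨(Subalgebra.equivOfEq _ _ hrange.symm).trans (AlgEquiv.ofInjective σ hinj).symm⟩
  left
  rw [injective_iff_map_eq_zero] at hinj
  push Not at hinj
  obtain ⟨p, hp, hp0⟩ := hinj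
  have hcomp : ∀ q, ρ (σ q) = q.comp (ρ (φ X)) := by
    intro q
    induction q using Polynomial.induction_on' with
    | add p q hp hq => rw [map_add, map_add, hp, hq, add_comp]
    | monomial n c =>
      have h1 : ρ (C (c : D)) = C c := by
        have : ψ.rangeRestrict c = c := Subtype.ext (hψ c)
        simp [ρ, this]
      have h2 : σ X = φ X := by simp [σ, j]
      rw [← C_mul_X_pow_eq_monomial, map_mul, map_pow, map_mul, map_pow, hσC, h1, h2]
      simp
  have hconst : ρ (φ X) = C ((ρ (φ X)).coeff 0) := by
    have h0 : p.comp (ρ (φ X)) = 0 := by rw [← hcomp, hp, map_zero]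
    exact ((comp_eq_zero_iff.1 h0).resolve_left hp0).2
  set c₀ := (ρ (φ X)).coeff 0
  have hX : φ X = C (c₀ : D) := by
    rw [← hφφ, ← hσρ', hconst, hσC]
  let κ : ψ.range →ₐ[R] D[X] := CAlgHom.comp ψ.range.val
  have hκ : Function.Injective κ := fun a b h => Subtype.ext (C_injective h)
  have hσκ : κ.range = φ.range := by
    apply le_antisymm
    · rintro _ ⟨c, rfl⟩
      exact ⟨C (c : D), (hC c).trans (congrArg C (hψ c))⟩
    · rw [← hrange]
      rintro _ ⟨q, rfl⟩
      change σ q ∈ κ.range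
      induction q using Polynomial.induction_on' with
      | add p q hp hq => rw [map_add]; exact add_mem hp hq
      | monomial n c =>
        have h2 : σ X = φ X := by simp [σ, j]
        rw [← C_mul_X_pow_eq_monomial, map_mul, map_pow, hσC, h2, hX]
        exact mul_mem (κ.mem_range_self c) (pow_mem (κ.mem_range_self c₀) n)
  exact ⟨(Subalgebra.equivOfEq _ _ hσκ.symm).trans (AlgEquiv.ofInjective κ hκ).symm⟩

end Polynomial

namespace MixedLaurent

open AddMonoidAlgebra

/-- Without polynomial variables, the mixed ring is the group algebra of `ℤ^d`. -/
noncomputable def zeroEquiv (R : Type*) [CommRing R] (d : ℕ) :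
    MixedLaurent R d 0 ≃ₐ[R] AddMonoidAlgebra R (Fin d → ℤ) :=
  domCongr R R AddEquiv.prodUnique

/-- With one polynomial variable, the mixed ring is the polynomial ring over the group algebra of
`ℤ^d`. -/
noncomputable def oneEquiv (R : Type*) [CommRing R] (d : ℕ) :
    MixedLaurent R d 1 ≃ₐ[R] Polynomial (AddMonoidAlgebra R (Fin d → ℤ)) :=
  (domCongr R R (AddEquiv.prodComm.trans
    (AddEquiv.prodCongr (AddEquiv.piUnique fun _ : Fin 1 => ℕ) (AddEquiv.refl _)))).trans
    ((curryAlgEquiv R).trans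
      ((Polynomial.toFinsuppIsoAlg (AddMonoidAlgebra R (Fin d → ℤ))).restrictScalars R).symm)

/-- The group `U_R` of a mixed Laurent/polynomial ring in `r` invertible variables has rank `r`. -/
theorem groupRank_URGroup {R A : Type*} [CommRing R] [IsDomain R] [CommRing A] [Algebra R A]
    {r s : ℕ} (e : A ≃ₐ[R] MixedLaurent R r s) : groupRank (URGroup R A) = r := by
  let mon : Multiplicative (Fin r → ℤ) →* A :=
    (e.symm : MixedLaurent R r s →* A).comp ((AddMonoidAlgebra.of R _).comp
      (AddMonoidHom.toMultiplicative (AddMonoidHom.inl (Fin r → ℤ) (Fin s → ℕ))))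
  have hmon : ∀ a, e (mon a) = single (a.toAdd, 0) 1 := fun a => e.apply_symm_apply _
  let Θ : Multiplicative (Fin r → ℤ) →* URGroup R A :=
    (QuotientGroup.mk' _).comp mon.toHomUnits
  have hinj : Function.Injective Θ := by
    rw [injective_iff_map_eq_one]
    intro a ha
    obtain ⟨t, ht⟩ := (QuotientGroup.eq_one_iff _).1 ha
    have h1 : algebraMap R A t = mon a := congrArg Units.val ht
    have h2 := congrArg e h1
    rw [hmon, AlgEquiv.commutes] at h2
    have h3 := congrArg coeff h2
    rw [AddMonoidAlgebra.coe_algebraMap] at h3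
    simp only [Function.comp, coeff_single] at h3
    obtain ⟨h4, -⟩ | ⟨-, h4⟩ := (Finsupp.single_eq_single_iff _ _ _ _).1 h3
    · exact (congrArg Prod.fst h4).symm
    · exact absurd h4 one_ne_zero
  have hsurj : Function.Surjective Θ := by
    intro q
    obtain ⟨u, rfl⟩ := QuotientGroup.mk_surjective q
    have huv : e u * e (u⁻¹ : Aˣ) = 1 := by rw [← map_mul, Units.mul_inv, map_one]
    obtain ⟨a, b, t, t', hab, htt, hu, -⟩ := exists_eq_single_of_mul_eq_one huv
    have ha2 : a.2 = 0 := by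
      have := congrArg Prod.snd hab
      funext i
      have := congrFun this i
      simp only [Prod.snd_add, Pi.add_apply, Prod.snd_zero, Pi.zero_apply] at this ⊢
      omega
    refine ⟨Multiplicative.ofAdd a.1, ?_⟩
    refine QuotientGroup.eq.2 ⟨Units.mkOfMulEqOne t t' htt, ?_⟩
    rw [eq_inv_mul_iff_mul_eq]
    apply Units.ext
    apply e.injective
    change e (mon _ * algebraMap R A t) = e u
    rw [map_mul, hmon, AlgEquiv.commutes, hu, AddMonoidAlgebra.coe_algebraMap]
    simp [single_mul_single, ← ha2]
  exact groupRank_eq_of_mulEquiv (MulEquiv.ofBijective Θ ⟨hinj, hsurj⟩)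

/-- A retract of a mixed ring with at most one polynomial variable is a mixed ring. -/
theorem exists_range_algEquiv_of_idempotent {R : Type*} [CommRing R] [IsDomain R] {d m : ℕ}
    (hm : m ≤ 1) (φ : MixedLaurent R d m →ₐ[R] MixedLaurent R d m) (hφ : φ.comp φ = φ) :
    ∃ r s : ℕ, s ≤ 1 ∧ Nonempty (φ.range ≃ₐ[R] MixedLaurent R r s) := by
  have transport : ∀ {E : Type _} [CommRing E] [Algebra R E] (e : MixedLaurent R d m ≃ₐ[R] E),
      ∃ φ' : E →ₐ[R] E, φ'.comp φ' = φ' ∧ Nonempty (φ.range ≃ₐ[R] φ'.range) := by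
    intro E _ _ e
    let φ' : E →ₐ[R] E := (e : MixedLaurent R d m →ₐ[R] E).comp (φ.comp e.symm)
    have hrange : φ.range.map (e : MixedLaurent R d m →ₐ[R] E) = φ'.range := by
      ext x
      constructor
      · rintro ⟨_, ⟨y, rfl⟩, rfl⟩
        exact ⟨e y, by simp [φ']⟩
      · rintro ⟨y, rfl⟩
        exact ⟨φ (e.symm y), ⟨_, rfl⟩, rfl⟩
    refine ⟨φ', ?_, ⟨(e.subalgebraMap φ.range).trans (Subalgebra.equivOfEq _ _ hrange)⟩⟩
    ext1 x
    have := DFunLike.congr_fun hφ (e.symm x)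
    simpa [φ'] using this
  obtain rfl | rfl : m = 0 ∨ m = 1 := by omega
  · obtain ⟨ψ, hψ, ⟨e⟩⟩ := transport (zeroEquiv R d)
    obtain ⟨r, ⟨f⟩⟩ := AddMonoidAlgebra.exists_range_algEquiv_of_idempotent ψ hψ
    exact ⟨r, 0, zero_le_one, ⟨e.trans (f.trans (zeroEquiv R r).symm)⟩⟩
  · obtain ⟨φ', hφ', ⟨e⟩⟩ := transport (oneEquiv R d)
    have hD : ∀ a, ∃ b, φ' (Polynomial.C a) = Polynomial.C b := by
      intro a
      induction a using AddMonoidAlgebra.induction_linear with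
      | zero => exact ⟨0, by simp⟩
      | add f g hf hg =>
        obtain ⟨b, hb⟩ := hf
        obtain ⟨b', hb'⟩ := hg
        exact ⟨b + b', by rw [map_add, map_add, hb, hb', map_add]⟩
      | single a t =>
        have hunit : IsUnit (single a 1 : AddMonoidAlgebra R (Fin d → ℤ)) := by
          refine IsUnit.of_mul_eq_one (single (-a) 1) ?_
          rw [single_mul_single, add_neg_cancel, one_mul, one_def]
        obtain ⟨b, -, hb⟩ := Polynomial.isUnit_iff.1 ((hunit.map Polynomial.C).map φ')
        refine ⟨t • b, ?_⟩
        have : (single a t : AddMonoidAlgebra R (Fin d → ℤ)) = t • single a 1 := by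
          rw [smul_single, smul_eq_mul, mul_one]
        rw [this, ← Polynomial.smul_C, map_smul, ← hb, Polynomial.smul_C]
    obtain ⟨ψ, hψ, hor⟩ := Polynomial.exists_range_algEquiv_of_idempotent φ' hφ' hD
    obtain ⟨r, ⟨f⟩⟩ := AddMonoidAlgebra.exists_range_algEquiv_of_idempotent ψ hψ
    obtain ⟨⟨g⟩⟩ | ⟨⟨g⟩⟩ := hor
    · exact ⟨r, 0, zero_le_one, ⟨e.trans (g.trans (f.trans (zeroEquiv R r).symm))⟩⟩
    · exact ⟨r, 1, le_rfl,
        ⟨e.trans (g.trans ((Polynomial.mapAlgEquiv f).trans (oneEquiv R r).symm))⟩⟩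

end MixedLaurent

/-- Let `R` be an integral domain, `1 ≤ d ≤ n` with `d ≥ n − 1` (i.e. `n = d + m` with
`m ≤ 1`), `B = R[x₁^{±1}, …, x_d^{±1}, x_{d+1}, …, xₙ]`, `φ` an idempotent `R`-algebra
endomorphism of `B`, `A = φ(B)` and `r = rank U_R(A)`.  Then
`A ≅ R^{[±r]} ⊗_R R^{[s]} = R[y₁^{±1}, …, y_r^{±1}, z₁, …, z_s]` for some `s ∈ {0, 1}`. -/
theorem retract_classification_high_d (R : Type*) [CommRing R] [IsDomain R] (d m : ℕ)
    (hd : 1 ≤ d) (hm : m ≤ 1)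
    (φ : MixedLaurent R d m →ₐ[R] MixedLaurent R d m) (hφ : φ.comp φ = φ)
    (r : ℕ) (hr : groupRank (URGroup R φ.range) = (r : Cardinal)) :
    ∃ s : ℕ, s ≤ 1 ∧ Nonempty (φ.range ≃ₐ[R] MixedLaurent R r s) := by
  obtain ⟨r', s, hs, ⟨e⟩⟩ := MixedLaurent.exists_range_algEquiv_of_idempotent hm φ hφ
  obtain rfl : r' = r := Nat.cast_injective ((MixedLaurent.groupRank_URGroup e).symm.trans hr)
  exact ⟨s, hs, ⟨e⟩⟩
end

section
/- Let R be a unique factorization domain, n ≥ 3, d = n − 2, B = R[x₁^{±1}, …, x_d^{±1}, x_{d+1}, …, xₙ], φ : B → B an R-algebra homomorphism with φ ∘ φ = φ, A = φ(B), and r the rank of U_R(A) = A^*/R^*. Then A is R-algebra isomorphic to R^{[±r]} ⊗_R R^{[s]} = R[y₁^{±1}, …, y_r^{±1}, z₁, …, z_s] for some s ∈ {0, 1, 2}. -/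
open Polynomial in
/-- An integral equation of degree `e` whose coefficients have degrees divisible by `e` has a
constant coefficient of degree `e`. -/
theorem natDegree_coeff_zero_eq_of_sum_eq_zero {L : Type*} [CommRing L] [IsDomain L] {e : ℕ}
    (he : e ≠ 0) (a : ℕ → L[X]) (hlead : a e = 1) (hdvd : ∀ i, e ∣ (a i).natDegree) {c : L}
    (hc : c ≠ 0) (h : ∑ i ∈ Finset.range (e + 1), a i * (C c * X) ^ i = 0) :
    (a 0).natDegree = e := by
  by_contra hne
  have hcX : (C c * X : L[X]) ≠ 0 := mul_ne_zero (C_ne_zero.2 hc) X_ne_zero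
  have hdeg : ∀ i, a i ≠ 0 → (a i * (C c * X) ^ i).natDegree = (a i).natDegree + i := by
    intro i hi
    rw [natDegree_mul hi (pow_ne_zero _ hcX), natDegree_pow, natDegree_C_mul hc, natDegree_X,
      mul_one]
  have key := natDegree_sum_eq_of_disjoint (fun i => a i * (C c * X) ^ i)
    (Finset.range (e + 1)) ?_
  · rw [h, natDegree_zero] at key
    have := Finset.le_sup (f := fun i => (a i * (C c * X) ^ i).natDegree)
      (Finset.self_mem_range_succ e)
    rw [← key, hdeg e (by simp [hlead])] at this
    omega
  · rintro i ⟨hi, hi0⟩ j ⟨hj, hj0⟩ hij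
    have hi1 : a i ≠ 0 := left_ne_zero_of_mul hi0
    have hj1 : a j ≠ 0 := left_ne_zero_of_mul hj0
    simp only [Function.onFun, Function.comp_apply, ne_eq]
    rw [hdeg i hi1, hdeg j hj1]
    intro heq
    rw [Finset.mem_range] at hi hj
    obtain ⟨k, hk⟩ := hdvd i
    obtain ⟨l, hl⟩ := hdvd j
    have hmod : i % e = j % e := by
      have := congrArg (· % e) heq
      simpa [hk, hl, Nat.add_mod] using this
    have aux : ∀ {i j : ℕ}, i < e + 1 → j < e + 1 → i ≠ j → i % e = j % e → i < j →
        i = 0 ∧ j = e := by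
      intro i j hi hj hij hm hlt
      rw [Nat.mod_eq_of_lt (by omega : i < e)] at hm
      rcases Nat.lt_or_ge j e with h1 | h1
      · rw [Nat.mod_eq_of_lt h1] at hm; omega
      · obtain rfl : j = e := by omega
        simp at hm; omega
    rcases lt_or_gt_of_ne hij with hlt | hlt
    · obtain ⟨rfl, rfl⟩ := aux hi hj hij hmod hlt
      rw [hlead] at heq
      simp at heq; omega
    · obtain ⟨rfl, rfl⟩ := aux hj hi hij.symm hmod.symm hlt
      rw [hlead] at heq
      simp at heq; omega

open Polynomial IntermediateField in
/-- A normal domain `A ⊆ L[X]`, not contained in `L`, has an element whose degree divides the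
degree of every element of `A`. -/
theorem exists_natDegree_dvd_natDegree {L A : Type*} [CommRing L] [IsDomain L] [CommRing A]
    [IsDomain A] [IsIntegrallyClosed A] [Algebra L A] (σ : A →ₐ[L] L[X])
    (hσ : Function.Injective σ) (hne : ∃ a, (σ a).natDegree ≠ 0) :
    ∃ f, (σ f).natDegree ≠ 0 ∧ ∀ a, (σ f).natDegree ∣ (σ a).natDegree := by
  obtain ⟨f, hf⟩ := hne
  let K := FractionRing L
  let ι : L[X] →+* RatFunc K := (algebraMap K[X] (RatFunc K)).comp (mapRingHom (algebraMap L K))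
  have hι : Function.Injective ι := (IsFractionRing.injective K[X] (RatFunc K)).comp
    (map_injective _ (IsFractionRing.injective L K))
  let τ : A →+* RatFunc K := ι.comp (σ : A →+* L[X])
  have hτ : Function.Injective τ := hι.comp hσ
  have hmem : ∀ x, x ∈ Subfield.closure (τ.range : Set (RatFunc K)) ↔
      ∃ a b, τ a / τ b = x := by
    intro x
    rw [Subfield.mem_closure_iff, Subring.closure_eq]
    constructor
    · rintro ⟨_, ⟨a, rfl⟩, _, ⟨b, rfl⟩, h⟩
      exact ⟨a, b, h⟩
    · rintro ⟨a, b, h⟩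
      exact ⟨_, ⟨a, rfl⟩, _, ⟨b, rfl⟩, h⟩
  have hτL : ∀ l : L, τ (algebraMap L A l) = algebraMap K (RatFunc K) (algebraMap L K l) := by
    intro l
    simp only [τ, ι, RingHom.comp_apply, RingHom.coe_coe, AlgHom.commutes]
    rw [Polynomial.algebraMap_eq, coe_mapRingHom, map_C]
    rfl
  let E : IntermediateField K (RatFunc K) :=
    { Subfield.closure (τ.range : Set (RatFunc K)) with
      algebraMap_mem' := fun k => by
        obtain ⟨l, m, -, rfl⟩ := IsFractionRing.div_surjective (A := L) k
        exact (hmem _).2 ⟨algebraMap L A l, algebraMap L A m, by rw [hτL, hτL, map_div₀]⟩ }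
  have hE : ∀ x, x ∈ E ↔ ∃ a b, τ a / τ b = x := hmem
  have hτE : ∀ a, τ a ∈ E := fun a => (hE _).2 ⟨a, 1, by simp⟩
  let τE : A →+* E := τ.codRestrict E hτE
  let _ : Algebra A E := τE.toAlgebra
  let _ : Algebra A L[X] := (σ : A →+* L[X]).toAlgebra
  let _ : Algebra A (RatFunc K) := τ.toAlgebra
  let _ : Algebra L[X] (RatFunc K) := ι.toAlgebra
  have : IsScalarTower A E (RatFunc K) := IsScalarTower.of_algebraMap_eq fun _ => rfl
  have : IsScalarTower A L[X] (RatFunc K) := IsScalarTower.of_algebraMap_eq fun _ => rfl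
  have hτE_inj : Function.Injective τE := fun x y h => hτ (congrArg Subtype.val h)
  have : FaithfulSMul A E := (faithfulSMul_iff_algebraMap_injective A E).2 hτE_inj
  have : IsFractionRing A E := IsFractionRing.of_field A E fun z => by
    obtain ⟨a, b, h⟩ := (hE z).1 z.2
    exact ⟨a, b, Subtype.ext h.symm⟩
  have hιdeg : ∀ q : L[X], max (ι q).num.natDegree (ι q).denom.natDegree = q.natDegree := by
    intro q
    simp [ι, RatFunc.num_algebraMap, RatFunc.denom_algebraMap,
      natDegree_map_eq_of_injective (IsFractionRing.injective L K)]
  have hdvd : ∀ a, Module.finrank E (RatFunc K) ∣ (σ a).natDegree := by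
    intro a
    have h1 : K⟮τ a⟯ ≤ E := adjoin_simple_le_iff.2 (hτE a)
    have h2 := relfinrank_mul_finrank_top h1
    rw [RatFunc.finrank_eq_max_natDegree, show τ a = ι (σ a) from rfl, hιdeg] at h2
    exact ⟨_, by rw [← h2, mul_comm]⟩
  set c := (σ f).leadingCoeff with hc
  have hc0 : c ≠ 0 := leadingCoeff_ne_zero.2 fun h => hf (by simp [h])
  have hint : IsIntegral A (C c * X : L[X]) := by
    have hinj : Function.Injective (algebraMap L A) := fun x y h =>
      C_injective (by simpa using congrArg σ h)
    have hdeg : (C f : A[X]).degree < ((σ f).map (algebraMap L A)).degree := by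
      rw [degree_map_eq_of_injective hinj]
      exact degree_C_le.trans_lt (natDegree_pos_iff_degree_pos.1 (Nat.pos_of_ne_zero hf))
    have h := isIntegral_leadingCoeff_smul ((σ f).map (algebraMap L A) - C f) (X : L[X]) (by
      have h2 : (algebraMap A L[X]).comp (algebraMap L A) = C := by
        ext1 l
        exact σ.commutes l
      rw [map_sub, aeval_C, aeval_def, eval₂_map, h2, eval₂_C_X]
      exact sub_self _)
    rw [leadingCoeff_sub_of_degree_lt hdeg, leadingCoeff_map_of_injective hinj, Algebra.smul_def]
      at h
    have h3 : algebraMap A L[X] (algebraMap L A c) = C c := σ.commutes c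
    rwa [h3] at h
  have hfin : Module.finrank E (RatFunc K) = (minpoly A (C c * X : L[X])).natDegree := by
    have hintE : IsIntegral E (ι (C c * X)) :=
      (hint.map (IsScalarTower.toAlgHom A L[X] (RatFunc K))).tower_top
    have htop : E⟮ι (C c * X)⟯ = ⊤ := by
      rw [_root_.eq_top_iff, ← RatFunc.IntermediateField.adjoin_X E, adjoin_simple_le_iff]
      have h1 : ι (C c) = algebraMap E (RatFunc K) (τE (algebraMap L A c)) := by
        change _ = ι (σ (algebraMap L A c))
        rw [σ.commutes, Polynomial.algebraMap_eq]
      have h2 : ι (C c) ≠ 0 := (map_ne_zero_iff ι hι).2 (C_ne_zero.2 hc0)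
      have h3 : ι X = RatFunc.X := by simp [ι]
      rw [← h3, ← inv_mul_cancel_left₀ h2 (ι X), ← map_mul]
      refine mul_mem (inv_mem ?_) (mem_adjoin_simple_self _ _)
      rw [h1]
      exact IntermediateField.algebraMap_mem _ _
    have h1 := minpoly.isIntegrallyClosed_eq_field_fractions E (RatFunc K) hint
    rw [← finrank_top', ← htop, IntermediateField.adjoin.finrank hintE]
    change (minpoly E (algebraMap L[X] (RatFunc K) (C c * X))).natDegree = _
    rw [h1, (minpoly.monic hint).natDegree_map]
  refine ⟨(minpoly A (C c * X : L[X])).coeff 0, ?_⟩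
  have hpos := minpoly.natDegree_pos hint
  rw [natDegree_coeff_zero_eq_of_sum_eq_zero (e := (minpoly A (C c * X : L[X])).natDegree)
    hpos.ne' (fun i => σ ((minpoly A (C c * X : L[X])).coeff i)) ?_ ?_ hc0 ?_]
  · exact ⟨hpos.ne', fun a => hfin ▸ hdvd a⟩
  · simp [minpoly.monic hint]
  · exact fun i => hfin ▸ hdvd _
  · have := minpoly.aeval A (C c * X : L[X])
    rw [aeval_eq_sum_range] at this
    simp only [Algebra.smul_def] at this
    exact this

/-- A retract of a normal domain is normal. -/
theorem IsIntegrallyClosed.of_retract {A P : Type*} [CommRing A] [IsDomain A] [CommRing P]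
    [IsDomain P] [IsIntegrallyClosed P] (i : A →+* P) (p : P →+* A)
    (h : p.comp i = RingHom.id A) : IsIntegrallyClosed A := by
  have hpi : ∀ a, p (i a) = a := fun a => congrArg (fun g : A →+* A => g a) h
  have hi : Function.Injective i := Function.LeftInverse.injective hpi
  have hj : Function.Injective ((algebraMap P (FractionRing P)).comp i) :=
    (IsFractionRing.injective P (FractionRing P)).comp hi
  rw [isIntegrallyClosed_iff (FractionRing A)]
  intro x hx
  let j : FractionRing A →+* FractionRing P := IsFractionRing.lift hj
  have hja : ∀ a, j (algebraMap A _ a) = algebraMap P _ (i a) :=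
    fun a => IsFractionRing.lift_algebraMap hj a
  have hjx : IsIntegral P (j x) := by
    obtain ⟨q, hq, hqx⟩ := hx
    refine ⟨q.map i, hq.map i, ?_⟩
    have h2 : (algebraMap P (FractionRing P)).comp i = j.comp (algebraMap A _) :=
      RingHom.ext fun a => (hja a).symm
    rw [Polynomial.eval₂_map, h2, ← Polynomial.hom_eval₂, hqx, map_zero]
  obtain ⟨c, hc⟩ := (isIntegrallyClosed_iff (FractionRing P)).1 ‹_› hjx
  obtain ⟨a, b, hb, rfl⟩ := IsFractionRing.div_surjective (A := A) x
  have hb0 : b ≠ 0 := nonZeroDivisors.ne_zero hb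
  refine ⟨p c, ?_⟩
  have hib : algebraMap P (FractionRing P) (i b) ≠ 0 := by
    rw [← hja]
    exact (map_ne_zero j).2 (IsFractionRing.to_map_ne_zero_of_mem_nonZeroDivisors hb)
  rw [map_div₀, hja, hja, eq_div_iff hib, ← map_mul] at hc
  have hc' := congrArg p (IsFractionRing.injective P (FractionRing P) hc)
  rw [map_mul, hpi, hpi] at hc'
  rw [eq_div_iff (IsFractionRing.to_map_ne_zero_of_mem_nonZeroDivisors hb), ← map_mul, hc']

section

open Polynomial

/-- If the degree of `f` divides all degrees occurring in `A ⊆ L[X]`, then every element of `A`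
is, up to a nonzero constant multiple, a polynomial in `f`. -/
theorem exists_smul_eq_aeval_of_natDegree_dvd {L A : Type*} [CommRing L] [IsDomain L] [CommRing A]
    [Algebra L A] (σ : A →ₐ[L] L[X]) (hσ : Function.Injective σ) {f : A}
    (hf : (σ f).natDegree ≠ 0) (hdvd : ∀ a, (σ f).natDegree ∣ (σ a).natDegree) (a : A) :
    ∃ d : L, d ≠ 0 ∧ ∃ q : L[X], d • a = aeval f q := by
  induction hn : (σ a).natDegree using Nat.strong_induction_on generalizing a with
  | _ n ih =>
    rcases Nat.eq_zero_or_pos n with rfl | hpos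
    · refine ⟨1, one_ne_zero, C ((σ a).coeff 0), hσ ?_⟩
      rw [one_smul, aeval_C, AlgHom.commutes]
      exact eq_C_of_natDegree_eq_zero hn
    · obtain ⟨k, hk⟩ := hdvd a
      set l := (σ f).leadingCoeff with hl
      have hl0 : l ≠ 0 := leadingCoeff_ne_zero.2 fun h => hf (by simp [h])
      set b := l ^ k • a - (σ a).leadingCoeff • f ^ k with hb
      have hσb : σ b = C (l ^ k) * σ a - C (σ a).leadingCoeff * σ f ^ k := by
        simp [hb, smul_eq_C_mul]
      have ha0 : σ a ≠ 0 := fun h => by simp [h] at hn; omega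
      have hlt : (σ b).natDegree < n := by
        have h1 : (C (l ^ k) * σ a).natDegree = n := by
          rw [natDegree_C_mul (pow_ne_zero _ hl0), hn]
        have h2 : (C (σ a).leadingCoeff * σ f ^ k).natDegree = n := by
          rw [natDegree_C_mul (leadingCoeff_ne_zero.2 ha0), natDegree_pow, ← hn, hk, mul_comm]
        rw [hσb]
        have hle := natDegree_sub_le_of_le h1.le h2.le
        refine lt_of_le_of_ne (by simpa using hle) fun heq => ?_
        have h0 : (C (l ^ k) * σ a - C (σ a).leadingCoeff * σ f ^ k).coeff n = 0 := by
          rw [coeff_sub]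
          conv_lhs => rw [← h1]
          rw [coeff_natDegree, h1, ← h2, coeff_natDegree]
          simp [hl, mul_comm]
        rw [← heq, coeff_natDegree, leadingCoeff_eq_zero] at h0
        rw [h0, natDegree_zero] at heq
        omega
      obtain ⟨d, hd, q, hq⟩ := ih _ hlt b rfl
      refine ⟨d * l ^ k, mul_ne_zero hd (pow_ne_zero _ hl0),
        q + C (d * (σ a).leadingCoeff) * X ^ k, ?_⟩
      rw [map_add, ← hq, hb]
      simp only [Algebra.smul_def, map_mul, map_pow, aeval_C, aeval_X]
      ring

/-- A prime constant that divides `q(f)`, where `f` is augmented to zero and not divisible by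
the prime, divides `q`. -/
theorem C_dvd_of_dvd_aeval {L A : Type*} [CommRing L] [CommRing A] [Algebra L A] (ε : A →ₐ[L] L)
    {f : A} (hεf : ε f = 0) {π : L} (hπ : Prime (algebraMap L A π)) (hπf : ¬ algebraMap L A π ∣ f)
    {q : L[X]} (hq : algebraMap L A π ∣ aeval f q) : C π ∣ q := by
  induction hn : q.natDegree using Nat.strong_induction_on generalizing q with
  | _ n ih =>
    have h0 : π ∣ q.coeff 0 := by
      have := map_dvd ε hq
      rw [AlgHom.commutes, ← aeval_algHom_apply, hεf] at this
      simpa [aeval_def, eval₂_at_zero] using this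
    have hsplit := divX_mul_X_add q
    have hdiv : algebraMap L A π ∣ aeval f q.divX := by
      rw [← hsplit, map_add, map_mul, aeval_X, aeval_C] at hq
      exact (hπ.dvd_or_dvd ((dvd_add_left (map_dvd _ h0)).1 hq)).resolve_right hπf
    have hX : C π ∣ q.divX := by
      rcases Nat.eq_zero_or_pos n with rfl | hpos
      · rw [eq_C_of_natDegree_eq_zero hn, divX_C]
        exact dvd_zero _
      · refine ih _ ?_ hdiv rfl
        rw [natDegree_divX_eq_natDegree_tsub_one]
        omega
    rw [← hsplit]
    exact dvd_add (hX.mul_right _) (map_dvd C h0)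

/-- Dividing out constants makes an element of `A ⊆ L[X]` primitive. -/
theorem exists_not_prime_dvd {L A : Type*} [CommRing L] [IsDomain L] [WfDvdMonoid L]
    [CommRing A] [Algebra L A] (σ : A →ₐ[L] L[X]) (ε : A →ₐ[L] L) (f : A)
    (hf : σ f ≠ 0) (hεf : ε f = 0) :
    ∃ g, (σ g).natDegree = (σ f).natDegree ∧ ε g = 0 ∧
      ∀ π : L, Prime π → ¬ algebraMap L A π ∣ g := by
  have wf : WellFounded (DvdNotUnit : L → L → Prop) := wellFounded_dvdNotUnit
  induction hc : (σ f).leadingCoeff using wf.induction generalizing f with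
  | _ c ih =>
    by_cases h : ∀ π : L, Prime π → ¬ algebraMap L A π ∣ f
    · exact ⟨f, rfl, hεf, h⟩
    · push Not at h
      obtain ⟨π, hπ, g, rfl⟩ := h
      have hσ : σ (algebraMap L A π * g) = C π * σ g := by
        rw [map_mul, AlgHom.commutes, Polynomial.algebraMap_eq]
      rw [hσ] at hf hc
      have hg : σ g ≠ 0 := right_ne_zero_of_mul hf
      rw [map_mul, AlgHom.commutes] at hεf
      rw [leadingCoeff_mul, leadingCoeff_C] at hc
      obtain ⟨g', h1, h2⟩ := ih (σ g).leadingCoeff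
        ⟨leadingCoeff_ne_zero.2 hg, π, hπ.not_isUnit, by rw [← hc, mul_comm]⟩ g hg
        ((mul_eq_zero.1 hεf).resolve_left hπ.ne_zero) rfl
      exact ⟨g', by rw [h1, hσ, natDegree_C_mul hπ.ne_zero], h2⟩

theorem transcendental_of_natDegree_ne_zero {L A : Type*} [CommRing L] [IsDomain L]
    [CommRing A] [Algebra L A] (σ : A →ₐ[L] L[X]) {f : A} (hf : (σ f).natDegree ≠ 0) :
    Transcendental L f := fun h =>
  (σ f).transcendental hf (mem_nonZeroDivisors_of_ne_zero
    (leadingCoeff_ne_zero.2 fun h0 => hf (by simp [h0]))) (h.algHom σ)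

theorem nonempty_algEquiv_polynomial {L A : Type*} [CommRing L] [IsDomain L]
    [UniqueFactorizationMonoid L] [CommRing A] [Algebra L A] [IsDomain A] [IsIntegrallyClosed A]
    (hprime : ∀ π : L, Prime π → Prime (algebraMap L A π)) (σ : A →ₐ[L] L[X])
    (hσ : Function.Injective σ) (hne : ∃ a, (σ a).natDegree ≠ 0) :
    Nonempty (A ≃ₐ[L] L[X]) := by
  obtain ⟨f₀, hf₀, hdvd⟩ := exists_natDegree_dvd_natDegree σ hσ hne
  let ε : A →ₐ[L] L := (aeval 0).comp σ
  have hdeg : (σ (f₀ - algebraMap L A (ε f₀))).natDegree = (σ f₀).natDegree := by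
    rw [map_sub, AlgHom.commutes, Polynomial.algebraMap_eq, natDegree_sub_C]
  obtain ⟨f, hf, hεf, hprim⟩ := exists_not_prime_dvd σ ε (f₀ - algebraMap L A (ε f₀))
    (fun h => hf₀ (by rw [← hdeg, h, natDegree_zero])) (by simp)
  rw [hdeg] at hf
  rw [← hf] at hf₀ hdvd
  have htr : Transcendental L f :=
    transcendental_of_natDegree_ne_zero σ hf₀
  refine ⟨(AlgEquiv.ofBijective (aeval f) ⟨transcendental_iff_injective.1 htr, fun a => ?_⟩).symm⟩
  obtain ⟨d, hd, q, hq⟩ := exists_smul_eq_aeval_of_natDegree_dvd σ hσ hf₀ hdvd a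
  induction d using UniqueFactorizationMonoid.induction_on_prime generalizing q with
  | h₁ => exact absurd rfl hd
  | h₂ d hu =>
    obtain ⟨u, rfl⟩ := hu
    refine ⟨(↑u⁻¹ : L) • q, ?_⟩
    rw [map_smul, ← hq, smul_smul, Units.inv_mul, one_smul]
  | h₃ d π hd0 hπ ih =>
    obtain ⟨q', rfl⟩ := C_dvd_of_dvd_aeval ε hεf (hprime π hπ) (hprim π hπ) (q := q)
      ⟨d • a, by rw [← hq, mul_smul, Algebra.smul_def]⟩
    refine ih hd0 q' ?_
    rw [map_mul, aeval_C, mul_smul, Algebra.smul_def] at hq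
    exact mul_left_cancel₀ (hprime π hπ).ne_zero hq

/-- The substitution `(X₀, X₁) ↦ (X, X ^ N)` with `N` large keeps `g` nonconstant. -/
theorem exists_natDegree_aeval_ne_zero {L : Type*} [CommRing L] (g : MvPolynomial (Fin 2) L)
    (hg : g ∉ Set.range MvPolynomial.C) :
    ∃ N : ℕ, (MvPolynomial.aeval ![(X : L[X]), X ^ N] g).natDegree ≠ 0 := by
  obtain ⟨m, hm, hm0⟩ : ∃ m ∈ g.support, m ≠ 0 := by
    by_contra! h
    refine hg ⟨g.coeff 0, ?_⟩
    ext m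
    rw [MvPolynomial.coeff_C]
    split_ifs with h0
    · rw [h0]
    · by_contra hm
      exact h0 (h m (MvPolynomial.mem_support_iff.2 (Ne.symm hm))).symm
  set N := g.totalDegree + 1 with hN
  have hlt : ∀ d ∈ g.support, d 0 < N := fun d hd =>
    Nat.lt_succ_of_le (((Finsupp.le_degree 0 d)).trans (MvPolynomial.le_totalDegree hd))
  have hsum : MvPolynomial.aeval ![(X : L[X]), X ^ N] g =
      ∑ d ∈ g.support, monomial (d 0 + N * d 1) (g.coeff d) := by
    rw [MvPolynomial.aeval_def, MvPolynomial.eval₂_eq']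
    refine Finset.sum_congr rfl fun d _ => ?_
    simp [Fin.prod_univ_two, ← C_mul_X_pow_eq_monomial, pow_add, pow_mul]
  have hcoeff : (MvPolynomial.aeval ![(X : L[X]), X ^ N] g).coeff (m 0 + N * m 1) =
      g.coeff m := by
    rw [hsum, finsetSum_coeff, Finset.sum_eq_single m]
    · simp
    · intro d hd hdm
      rw [coeff_monomial, if_neg]
      intro heq
      apply hdm
      have h0 : d 0 = m 0 := by
        have := congrArg (· % N) heq
        simpa [Nat.mod_eq_of_lt (hlt d hd), Nat.mod_eq_of_lt (hlt m hm)] using this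
      have h1 : d 1 = m 1 := Nat.eq_of_mul_eq_mul_left (Nat.succ_pos g.totalDegree) (by
        rw [h0] at heq
        exact Nat.add_left_cancel heq)
      ext j
      fin_cases j
      · exact h0
      · exact h1
    · exact fun h => absurd hm h
  refine ⟨N, fun h => ?_⟩
  have hpos : m 0 + N * m 1 ≠ 0 := by
    intro h0
    apply hm0
    ext j
    fin_cases j
    · simp; omega
    · simpa [hN] using (Nat.add_eq_zero_iff.1 h0).2
  rw [coeff_eq_zero_of_natDegree_lt (by omega)] at hcoeff
  exact MvPolynomial.mem_support_iff.1 hm hcoeff.symm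

/-- An algebraic element of the kernel of a map that is injective on the base vanishes. -/
theorem IsAlgebraic.eq_zero_of_map_eq_zero {R S T : Type*} [CommRing R] [CommRing S] [IsDomain S]
    [CommRing T] [Algebra R S] {g : S} (hg : IsAlgebraic R g) (p : S →+* T)
    (hp : Function.Injective (p.comp (algebraMap R S))) (hpg : p g = 0) : g = 0 := by
  by_contra h0
  obtain ⟨q, hq0, hq⟩ := hg.exists_nonzero_coeff_and_aeval_eq_zero
    (mem_nonZeroDivisors_of_ne_zero h0)
  apply hq0
  apply hp
  have := congrArg p hq
  rwa [aeval_def, hom_eval₂, hpg, eval₂_at_zero, map_zero,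
    ← map_zero (p.comp (algebraMap R S))] at this

/-- A retract of a polynomial ring in two variables over a factorial domain is a polynomial
ring. -/
theorem exists_algEquiv_mvPolynomial_of_retract.{u} {L A : Type u} [CommRing L] [IsDomain L]
    [UniqueFactorizationMonoid L] [CommRing A] [Algebra L A]
    (i : A →ₐ[L] MvPolynomial (Fin 2) L) (p : MvPolynomial (Fin 2) L →ₐ[L] A)
    (hpi : p.comp i = AlgHom.id L A) :
    ∃ s ≤ 2, Nonempty (A ≃ₐ[L] MvPolynomial (Fin s) L) := by
  have hpi' : ∀ a, p (i a) = a := fun a => congrArg (fun g : A →ₐ[L] A => g a) hpi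
  have hi : Function.Injective i := Function.LeftInverse.injective hpi'
  have hsurj : Function.Surjective p := fun a => ⟨i a, hpi' a⟩
  by_cases hp : Function.Injective p
  · exact ⟨2, le_rfl, ⟨(AlgEquiv.ofBijective p ⟨hp, hsurj⟩).symm⟩⟩
  by_cases hconst : ∀ a, i a ∈ Set.range MvPolynomial.C
  · refine ⟨0, by omega, ⟨((MvPolynomial.isEmptyAlgEquiv L (Fin 0)).trans
      (AlgEquiv.ofBijective (Algebra.ofId L A) ⟨?_, ?_⟩)).symm⟩⟩
    · intro x y hxy
      apply MvPolynomial.C_injective (Fin 2) L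
      simpa [Algebra.ofId_apply] using congrArg i hxy
    · intro a
      obtain ⟨l, hl⟩ := hconst a
      exact ⟨l, hi (by
        rw [← hl, Algebra.ofId_apply, AlgHom.commutes, MvPolynomial.algebraMap_eq])⟩
  push Not at hconst
  obtain ⟨f, hf⟩ := hconst
  obtain ⟨N, hN⟩ := exists_natDegree_aeval_ne_zero (i f) hf
  let σ : A →ₐ[L] L[X] := (MvPolynomial.aeval ![(X : L[X]), X ^ N]).comp i
  have hσf : (σ f).natDegree ≠ 0 := hN
  have : IsDomain A := hi.isDomain (i : A →+* MvPolynomial (Fin 2) L)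
  have : IsIntegrallyClosed A := .of_retract (i : A →+* MvPolynomial (Fin 2) L)
    (p : MvPolynomial (Fin 2) L →+* A)
    (RingHom.ext hpi')
  have hprime : ∀ π : L, Prime π → Prime (algebraMap L A π) := by
    intro π hπ
    have hP : Prime (i (algebraMap L A π)) := by
      rw [AlgHom.commutes, MvPolynomial.algebraMap_eq]
      exact (MvPolynomial.prime_C_iff _).2 hπ
    exact comap_prime i p hpi' hP
  have htr : Transcendental L f := transcendental_of_natDegree_ne_zero σ hσf
  have htrdeg : Algebra.trdeg L A ≤ 1 := by
    let _ : Algebra A (MvPolynomial (Fin 2) L) := (i : A →+* _).toAlgebra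
    have : IsScalarTower L A (MvPolynomial (Fin 2) L) :=
      IsScalarTower.of_algebraMap_eq fun l => (i.commutes l).symm
    have : FaithfulSMul A (MvPolynomial (Fin 2) L) :=
      (faithfulSMul_iff_algebraMap_injective _ _).2 hi
    have : FaithfulSMul L A := (faithfulSMul_iff_algebraMap_injective _ _).2
      (Algebra.injective_of_transcendental (h := ⟨f, htr⟩))
    have hadd := trdeg_add_eq L A (A := MvPolynomial (Fin 2) L)
    rw [MvPolynomial.trdeg_of_isDomain] at hadd
    have hne : Algebra.trdeg A (MvPolynomial (Fin 2) L) ≠ 0 := by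
      rw [Ne, trdeg_eq_zero_iff]
      intro halg
      refine hp ((injective_iff_map_eq_zero p).2 fun g hg => ?_)
      exact (halg.isAlgebraic g).eq_zero_of_map_eq_zero (p : _ →+* A)
        (fun x y hxy => by rw [← hpi' x, ← hpi' y]; exact hxy) hg
    have h1 := Cardinal.one_le_iff_ne_zero.2 hne
    by_contra! h2
    have h4 := add_le_add (Cardinal.two_le_iff_one_lt.2 h2) h1
    rw [hadd] at h4
    norm_num at h4
  have halg : Algebra.IsAlgebraic (Algebra.adjoin L {f}) A := by
    have hind : AlgebraicIndependent L (fun _ : Unit => f) :=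
      algebraicIndependent_unique_type_iff.2 htr
    have := (hind.isTranscendenceBasis_of_lift_trdeg_le_of_finite
      (by simpa using htrdeg)).isAlgebraic
    rwa [Set.range_const] at this
  have hσ : Function.Injective σ := by
    refine (injective_iff_map_eq_zero σ).2 fun a ha => ?_
    refine (halg.isAlgebraic a).eq_zero_of_map_eq_zero (σ : A →+* L[X]) ?_ ha
    rintro ⟨x, hx⟩ ⟨y, hy⟩ hxy
    rw [Algebra.adjoin_singleton_eq_range_aeval] at hx hy
    obtain ⟨x, rfl⟩ := hx
    obtain ⟨y, rfl⟩ := hy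
    have hσ_tr : Transcendental L (σ f) :=
      transcendental_of_natDegree_ne_zero (AlgHom.id L L[X]) hσf
    have hxy' : aeval (σ f) x = aeval (σ f) y := by
      rw [aeval_algHom_apply, aeval_algHom_apply]
      exact hxy
    exact Subtype.ext (congrArg (aeval f) (transcendental_iff_injective.1 hσ_tr hxy'))
  obtain ⟨e⟩ := nonempty_algEquiv_polynomial hprime σ hσ ⟨f, hσf⟩
  exact ⟨1, by omega, ⟨e.trans (MvPolynomial.uniqueAlgEquiv L (Fin 1)).symm⟩⟩

end

/-- Over a domain, invertible elements of the monoid algebra of a monoid with two unique sums are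
monomials. -/
theorem AddMonoidAlgebra.exists_eq_single_of_mul_eq_one_s16 {R M : Type*} [CommRing R] [IsDomain R]
    [AddCommMonoid M] [TwoUniqueSums M] {u v : AddMonoidAlgebra R M} (h : u * v = 1) :
    ∃ a c b e, a + b = 0 ∧ c * e = 1 ∧ u = single a c ∧ v = single b e := by
  classical
  have hzero : ∀ p ∈ u.coeff.support ×ˢ v.coeff.support,
      UniqueAdd u.coeff.support v.coeff.support p.1 p.2 → p.1 + p.2 = 0 := by
    intro p hp hup
    rw [Finset.mem_product, Finsupp.mem_support_iff, Finsupp.mem_support_iff] at hp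
    have := coeff_mul_add_of_uniqueAdd hup
    rw [h, one_def, coeff_single, Finsupp.single_apply] at this
    by_contra hne
    rw [if_neg (Ne.symm hne)] at this
    exact mul_ne_zero hp.1 hp.2 this.symm
  have hcard : u.coeff.support.card * v.coeff.support.card ≤ 1 := by
    by_contra! hlt
    obtain ⟨p, hp, q, hq, hne, hup, huq⟩ := TwoUniqueSums.uniqueAdd_of_one_lt_card hlt
    have hq' := Finset.mem_product.1 hq
    have := hup hq'.1 hq'.2 ((hzero q hq huq).trans (hzero p hp hup).symm)
    exact hne (Prod.ext this.1.symm this.2.symm)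
  have hne : ∀ w : AddMonoidAlgebra R M, w ≠ 0 → 1 ≤ w.coeff.support.card := fun w hw =>
    Finset.card_pos.2 (Finsupp.support_nonempty_iff.2 fun h0 => hw (coeff_eq_zero.1 h0))
  have hu := hne u (left_ne_zero_of_mul_eq_one h)
  have hv := hne v (right_ne_zero_of_mul_eq_one h)
  have hsingle : ∀ w : AddMonoidAlgebra R M, w.coeff.support.card = 1 → ∃ a c, w = single a c := by
    intro w hw
    obtain ⟨a, c, -, hac⟩ := Finsupp.card_support_eq_one'.1 hw
    exact ⟨a, c, coeff_injective (by rw [hac, coeff_single])⟩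
  obtain ⟨a, c, rfl⟩ := hsingle u (by nlinarith)
  obtain ⟨b, e, rfl⟩ := hsingle v (by nlinarith)
  rw [single_mul_single, one_def] at h
  have h' := congrArg coeff h
  rw [coeff_single, coeff_single, Finsupp.single_eq_single_iff] at h'
  rcases h' with h' | h'
  · exact ⟨a, c, b, e, h'.1, h'.2, rfl, rfl⟩
  · exact absurd h'.2 one_ne_zero

theorem AddMonoidAlgebra.uniqueFactorizationMonoid_pi_int (R : Type*) [CommRing R] [IsDomain R]
    [UniqueFactorizationMonoid R] (r : ℕ) :
    UniqueFactorizationMonoid (AddMonoidAlgebra R (Fin r → ℤ)) := by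
  induction r with
  | zero => exact (uniqueRingEquiv (Fin 0 → ℤ)).symm.toMulEquiv.uniqueFactorizationMonoid ‹_›
  | succ r ih =>
    let e : AddMonoidAlgebra R (Fin (r + 1) → ℤ) ≃+*
        LaurentPolynomial (AddMonoidAlgebra R (Fin r → ℤ)) :=
      (domCongr R R (Fin.consLinearEquiv ℤ fun _ => ℤ).symm.toAddEquiv).toRingEquiv.trans
        curryRingEquiv
    have : UniqueFactorizationMonoid (LaurentPolynomial (AddMonoidAlgebra R (Fin r → ℤ))) :=
      .of_isLocalization
        (.powers (Polynomial.X : Polynomial (AddMonoidAlgebra R (Fin r → ℤ)))) _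
    exact e.symm.toMulEquiv.uniqueFactorizationMonoid this

/-- A retract of a polynomial ring `S[X₀, X₁]` whose retraction carries `S` onto a factorial
domain `L` is a polynomial ring over `L`. -/
theorem exists_range_algEquiv_mvPolynomial.{u} {R S L B : Type u} [CommRing R] [CommRing S]
    [Algebra R S] [CommRing L] [Algebra R L] [IsDomain L] [UniqueFactorizationMonoid L]
    [CommRing B] [Algebra R B] (κ : MvPolynomial (Fin 2) S ≃ₐ[R] B) (φ : B →ₐ[R] B)
    (hφ : φ.comp φ = φ) (ρ : L →ₐ[R] S) (hρ : Function.Injective ρ) (θ : S →ₐ[R] L)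
    (hφρ : ∀ l, φ (κ (MvPolynomial.C (ρ l))) = κ (MvPolynomial.C (ρ l)))
    (hφθ : ∀ s, φ (κ (MvPolynomial.C s)) = κ (MvPolynomial.C (ρ (θ s)))) :
    ∃ s ≤ 2, Nonempty (φ.range ≃ₐ[R] MvPolynomial (Fin s) L) := by
  have hφ' : ∀ b, φ (φ b) = φ b := fun b => congrArg (fun f : B →ₐ[R] B => f b) hφ
  have hθρ : ∀ l, θ (ρ l) = l := fun l =>
    hρ (MvPolynomial.C_injective _ _ (κ.injective ((hφθ (ρ l)).symm.trans (hφρ l))))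
  let η : L →ₐ[R] φ.range := φ.rangeRestrict.comp ((κ : _ →ₐ[R] B).comp
    ((IsScalarTower.toAlgHom R S (MvPolynomial (Fin 2) S)).comp ρ))
  let _ : Algebra L φ.range := (η : L →+* φ.range).toAlgebra
  have : IsScalarTower R L φ.range := IsScalarTower.of_algebraMap_eq fun x => (η.commutes x).symm
  have hη : ∀ l, algebraMap L φ.range l = φ.rangeRestrict (κ (MvPolynomial.C (ρ l))) :=
    fun _ => rfl
  let q : B →ₐ[R] MvPolynomial (Fin 2) L :=
    (MvPolynomial.mapAlgHom θ).comp (κ.symm : B →ₐ[R] MvPolynomial (Fin 2) S)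
  let i : φ.range →ₐ[L] MvPolynomial (Fin 2) L :=
    { (q.comp φ.range.val : φ.range →+* MvPolynomial (Fin 2) L) with
      commutes' := fun l => by
        change q (φ (κ (MvPolynomial.C (ρ l)))) = _
        simp [q, hφρ, hθρ, MvPolynomial.algebraMap_eq] }
  let p : MvPolynomial (Fin 2) L →ₐ[L] φ.range :=
    MvPolynomial.aeval fun j => φ.rangeRestrict (κ (MvPolynomial.X j))
  have hpq : ∀ b, p (q (κ b)) = φ.rangeRestrict (κ b) := by
    intro b
    suffices h : ((p.restrictScalars R).comp
        (q.comp (κ : MvPolynomial (Fin 2) S →ₐ[R] B))).toRingHom =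
        (φ.rangeRestrict.comp (κ : MvPolynomial (Fin 2) S →ₐ[R] B)).toRingHom from
      congrArg (fun f : _ →+* φ.range => f b) h
    refine MvPolynomial.ringHom_ext (fun s => ?_) fun j => ?_
    · have : p (q (κ (MvPolynomial.C s))) = φ.rangeRestrict (κ (MvPolynomial.C s)) := by
        have h : q (κ (MvPolynomial.C s)) = algebraMap L _ (θ s) := by
          simp [q, MvPolynomial.algebraMap_eq]
        rw [h, AlgHom.commutes, hη]
        exact Subtype.ext ((hφρ _).trans (hφθ s).symm)
      exact this
    · have : p (q (κ (MvPolynomial.X j))) = φ.rangeRestrict (κ (MvPolynomial.X j)) := by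
        have h : q (κ (MvPolynomial.X j)) = MvPolynomial.X j := by simp [q]
        rw [h, MvPolynomial.aeval_X]
      exact this
  obtain ⟨s, hs, ⟨e⟩⟩ := exists_algEquiv_mvPolynomial_of_retract i p <| AlgHom.ext fun a => by
    obtain ⟨_, b, rfl⟩ := a
    have h := hpq (κ.symm (φ b))
    rw [κ.apply_symm_apply] at h
    exact h.trans (Subtype.ext (hφ' b))
  exact ⟨s, hs, ⟨e.restrictScalars R⟩⟩

/-- The mixed Laurent polynomial ring in a basis of an abelian group `G`, as a polynomial ring over
the group algebra of `G`. -/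
noncomputable def mvPolynomialAlgEquivMixedLaurent (R : Type*) [CommRing R] {G : Type*}
    [AddCommGroup G] {r : ℕ} (s : ℕ) (e : G ≃+ (Fin r → ℤ)) :
    MvPolynomial (Fin s) (AddMonoidAlgebra R G) ≃ₐ[R] MixedLaurent R r s :=
  (AddMonoidAlgebra.curryAlgEquiv R (A := R) (M := Fin s →₀ ℕ) (N := G)).symm.trans
    (AddMonoidAlgebra.domCongr R R (AddEquiv.prodComm.trans
      (e.prodCongr (Finsupp.linearEquivFunOnFinite ℕ ℕ (Fin s)).toAddEquiv)))

theorem mvPolynomialAlgEquivMixedLaurent_C_single (R : Type*) [CommRing R] {G : Type*}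
    [AddCommGroup G] {r : ℕ} (s : ℕ) (e : G ≃+ (Fin r → ℤ)) (g : G) (c : R) :
    mvPolynomialAlgEquivMixedLaurent R s e (MvPolynomial.C (AddMonoidAlgebra.single g c)) =
      AddMonoidAlgebra.single (e g, 0) c := by
  change AddMonoidAlgebra.domCongr R R _ ((AddMonoidAlgebra.curryAlgEquiv R).symm
    (AddMonoidAlgebra.single (0 : Fin s →₀ ℕ) (AddMonoidAlgebra.single g c))) = _
  simp only [AddMonoidAlgebra.curryAlgEquiv_symm_single, AddMonoidAlgebra.domCongr_single]
  rfl

theorem finrank_eq_of_groupRank_eq {G H : Type*} [CommGroup G] [AddCommGroup H]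
    (e : H ≃+ Additive G) {r : ℕ} (hr : groupRank G = r) : Module.finrank ℤ H = r := by
  rw [(AddEquiv.toIntLinearEquiv e).finrank_eq]
  exact Module.finrank_eq_of_rank_eq hr

section FixedExponents

variable {R : Type*} [CommRing R] {d m : ℕ}

/-- Invertible elements of a mixed Laurent polynomial ring over a domain are Laurent monomials. -/
theorem MixedLaurent.exists_eq_single_of_isUnit [IsDomain R] {u : MixedLaurent R d m}
    (hu : IsUnit u) :
    ∃ (a : Fin d → ℤ) (c : R), IsUnit c ∧ u = AddMonoidAlgebra.single (a, 0) c := by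
  obtain ⟨v, hv⟩ := hu.exists_right_inv
  obtain ⟨a, c, b, e, hab, hce, rfl, -⟩ :=
    AddMonoidAlgebra.exists_eq_single_of_mul_eq_one_s16 hv
  refine ⟨a.1, c, .of_mul_eq_one _ hce, ?_⟩
  have : a.2 = 0 := by
    ext j
    exact (Nat.add_eq_zero_iff.1 (congrFun (congrArg Prod.snd hab) j)).1
  rw [← this]

theorem MixedLaurent.single_mul_single_neg (a : Fin d → ℤ) :
    (AddMonoidAlgebra.single (a, 0) 1 : MixedLaurent R d m) *
      AddMonoidAlgebra.single (-a, 0) 1 = 1 := by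
  rw [AddMonoidAlgebra.single_mul_single, Prod.mk_add_mk, add_neg_cancel, add_zero, one_mul]
  rfl

/-- The exponents of the Laurent monomials fixed by an endomorphism. -/
def fixedExponents (φ : MixedLaurent R d m →ₐ[R] MixedLaurent R d m) :
    AddSubgroup (Fin d → ℤ) where
  carrier := {a | φ (AddMonoidAlgebra.single (a, 0) 1) = AddMonoidAlgebra.single (a, 0) 1}
  zero_mem' := map_one φ
  add_mem' {a b} ha hb := by
    have h : (AddMonoidAlgebra.single (a + b, 0) 1 : MixedLaurent R d m) =
        AddMonoidAlgebra.single (a, 0) 1 * AddMonoidAlgebra.single (b, 0) 1 := by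
      simp [AddMonoidAlgebra.single_mul_single]
    change φ _ = _
    rw [h, map_mul, ha, hb]
  neg_mem' {a} ha := by
    have h := congrArg φ (MixedLaurent.single_mul_single_neg (R := R) (m := m) a)
    rw [map_mul, map_one, ha] at h
    exact left_inv_eq_right_inv ((mul_comm _ _).trans h) (MixedLaurent.single_mul_single_neg a)

variable {φ : MixedLaurent R d m →ₐ[R] MixedLaurent R d m}

/-- Invertible elements fixed by `φ` are monomials with exponent in `fixedExponents φ`. -/
theorem exists_fixedExponents_of_isUnit [IsDomain R] {u : MixedLaurent R d m}
    (hu : IsUnit u) (hφu : φ u = u) :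
    ∃ (a : fixedExponents φ) (c : R), IsUnit c ∧ u = AddMonoidAlgebra.single (a.1, 0) c := by
  obtain ⟨a, c, hc, rfl⟩ := MixedLaurent.exists_eq_single_of_isUnit hu
  refine ⟨⟨a, ?_⟩, c, hc, rfl⟩
  have h : (AddMonoidAlgebra.single (a, 0) c : MixedLaurent R d m) =
      c • AddMonoidAlgebra.single (a, 0) 1 := by simp
  rw [h, map_smul] at hφu
  exact hc.smul_left_cancel.1 hφu

/-- The unit of the image of `φ` given by a fixed Laurent monomial. -/
noncomputable def fixedMonomial (φ : MixedLaurent R d m →ₐ[R] MixedLaurent R d m) :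
    Multiplicative (fixedExponents φ) →* φ.rangeˣ :=
  MonoidHom.toHomUnits
    { toFun := fun a => ⟨AddMonoidAlgebra.single (a.toAdd.1, 0) 1, _, a.toAdd.2⟩
      map_one' := rfl
      map_mul' := fun a b => Subtype.ext (by simp [AddMonoidAlgebra.single_mul_single]) }

/-- Modulo scalars, the fixed Laurent monomials are exactly the units of the image of `φ`. -/
theorem bijective_mk_fixedMonomial [IsDomain R] (hφ : φ.comp φ = φ) :
    Function.Bijective ((QuotientGroup.mk'
      (Units.map (algebraMap R φ.range : R →* φ.range)).range).comp (fixedMonomial φ)) := by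
  constructor
  · refine (injective_iff_map_eq_one _).2 fun a ha => ?_
    obtain ⟨c, hc⟩ := (QuotientGroup.eq_one_iff _).1 ha
    have h : (AddMonoidAlgebra.single 0 (c : R) : MixedLaurent R d m) =
        AddMonoidAlgebra.single (a.toAdd.1, 0) 1 :=
      congrArg (fun u : φ.rangeˣ => ((u : φ.range) : MixedLaurent R d m)) hc
    have h' := congrArg AddMonoidAlgebra.coeff h
    rw [AddMonoidAlgebra.coeff_single, AddMonoidAlgebra.coeff_single,
      Finsupp.single_eq_single_iff] at h'
    rcases h' with h' | h'
    · exact Subtype.ext (congrArg Prod.fst h'.1).symm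
    · exact absurd h'.2 one_ne_zero
  · intro x
    obtain ⟨u, rfl⟩ := QuotientGroup.mk_surjective x
    have hφu : φ (u : φ.range) = (u : φ.range) := by
      obtain ⟨b, hb⟩ := (u : φ.range).2
      have hb : φ b = (u : φ.range) := hb
      rw [← hb]
      exact congrArg (fun f : _ →ₐ[R] MixedLaurent R d m => f b) hφ
    obtain ⟨a, c, hc, h⟩ := exists_fixedExponents_of_isUnit (u.isUnit.map φ.range.val) hφu
    refine ⟨.ofAdd a, QuotientGroup.eq.2 ⟨hc.unit, ?_⟩⟩
    rw [eq_inv_mul_iff_mul_eq]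
    refine Units.ext (Subtype.ext (Eq.trans ?_ h.symm))
    change AddMonoidAlgebra.single (a.1, 0) 1 * AddMonoidAlgebra.single 0 c = _
    simp [AddMonoidAlgebra.single_mul_single]

/-- The exponents of the fixed Laurent monomials form a free abelian group whose rank is that of
the unit group of the image modulo scalars. -/
theorem nonempty_fixedExponents_addEquiv [IsDomain R] (hφ : φ.comp φ = φ) {r : ℕ}
    (hr : groupRank (URGroup R φ.range) = r) : Nonempty (fixedExponents φ ≃+ (Fin r → ℤ)) := by
  let e : fixedExponents φ ≃+ Additive (URGroup R φ.range) :=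
    MulEquiv.toAdditiveRight (MulEquiv.ofBijective _ (bijective_mk_fixedMonomial hφ))
  have hrank : Module.finrank ℤ (fixedExponents φ) = r :=
    finrank_eq_of_groupRank_eq e hr
  have : Module.Free ℤ (fixedExponents φ) :=
    inferInstanceAs (Module.Free ℤ (AddSubgroup.toIntSubmodule (fixedExponents φ)))
  have : Module.Finite ℤ (fixedExponents φ) :=
    inferInstanceAs (Module.Finite ℤ (AddSubgroup.toIntSubmodule (fixedExponents φ)))
  exact ⟨((Module.finBasisOfFinrankEq ℤ _ hrank).equivFun).toAddEquiv⟩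

end FixedExponents

/-- Let `R` be a UFD, `n ≥ 3` and `d = n − 2` with `d ≥ 1` (i.e. `n = d + 2`),
`B = R[x₁^{±1}, …, x_d^{±1}, x_{d+1}, …, xₙ]`, `φ` an idempotent `R`-algebra endomorphism of
`B`, `A = φ(B)` and `r = rank U_R(A)`.  Then
`A ≅ R^{[±r]} ⊗_R R^{[s]} = R[y₁^{±1}, …, y_r^{±1}, z₁, …, z_s]` for some `s ∈ {0, 1, 2}`. -/
theorem retract_classification_codim_two (R : Type*) [CommRing R] [IsDomain R]
    [UniqueFactorizationMonoid R] (d : ℕ) (hd : 1 ≤ d)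
    (φ : MixedLaurent R d 2 →ₐ[R] MixedLaurent R d 2) (hφ : φ.comp φ = φ)
    (r : ℕ) (hr : groupRank (URGroup R φ.range) = (r : Cardinal)) :
    ∃ s : ℕ, s ≤ 2 ∧ Nonempty (φ.range ≃ₐ[R] MixedLaurent R r s) := by
  obtain ⟨e⟩ := nonempty_fixedExponents_addEquiv hφ hr
  let κ := mvPolynomialAlgEquivMixedLaurent R 2 (AddEquiv.refl (Fin d → ℤ))
  have hκ : ∀ a c, κ (MvPolynomial.C (AddMonoidAlgebra.single a c)) =
      AddMonoidAlgebra.single (a, 0) c :=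
    mvPolynomialAlgEquivMixedLaurent_C_single R 2 _
  have : UniqueFactorizationMonoid (AddMonoidAlgebra R (fixedExponents φ)) :=
    (AddMonoidAlgebra.domCongr R R e).symm.toMulEquiv.uniqueFactorizationMonoid
      (AddMonoidAlgebra.uniqueFactorizationMonoid_pi_int R r)
  have : IsDomain (AddMonoidAlgebra R (fixedExponents φ)) :=
    (AddMonoidAlgebra.domCongr R R e).toMulEquiv.isDomain _
  let ρ : AddMonoidAlgebra R (fixedExponents φ) →ₐ[R] AddMonoidAlgebra R (Fin d → ℤ) :=
    AddMonoidAlgebra.mapDomainAlgHom R R (fixedExponents φ).subtype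
  have hρs : ∀ g c, ρ (AddMonoidAlgebra.single g c) = AddMonoidAlgebra.single g.1 c :=
    fun g c => by simp [ρ]
  have hρ : Function.Injective ρ :=
    AddMonoidAlgebra.mapDomain_injective (fixedExponents φ).subtype_injective
  let ι : AddMonoidAlgebra R (Fin d → ℤ) →ₐ[R] MixedLaurent R d 2 :=
    (κ : MvPolynomial (Fin 2) (AddMonoidAlgebra R (Fin d → ℤ)) →ₐ[R] MixedLaurent R d 2).comp
      (IsScalarTower.toAlgHom R _ _)
  have hι_C : ∀ x, ι x = κ (MvPolynomial.C x) := fun _ => rfl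
  have hι : Function.Injective ι := κ.injective.comp (MvPolynomial.C_injective _ _)
  have hφρ : φ.comp (ι.comp ρ) = ι.comp ρ := by
    apply AddMonoidAlgebra.algHom_ext
    case single_zero_left => ext
    intro g
    change φ (ι (ρ (AddMonoidAlgebra.single g 1))) = ι (ρ (AddMonoidAlgebra.single g 1))
    rw [hρs, hι_C, hκ]
    exact g.2
  have hmem : ∀ x : AddMonoidAlgebra R (Fin d → ℤ), φ (ι x) ∈ (ι.comp ρ).range := by
    intro x
    induction x using AddMonoidAlgebra.induction_on with
    | of a =>
      have hu : IsUnit (φ (ι (AddMonoidAlgebra.single a 1))) := by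
        rw [hι_C, hκ]
        exact (IsUnit.of_mul_eq_one _ (MixedLaurent.single_mul_single_neg a)).map φ
      obtain ⟨g, c, -, h⟩ := exists_fixedExponents_of_isUnit (φ := φ) hu
        (DFunLike.congr_fun hφ _)
      refine ⟨AddMonoidAlgebra.single g c, Eq.trans ?_ h.symm⟩
      change ι (ρ (AddMonoidAlgebra.single g c)) = _
      rw [hρs, hι_C, hκ]
    | add x y hx hy =>
      rw [map_add, map_add]
      exact add_mem hx hy
    | smul c x hx =>
      rw [map_smul, map_smul]
      exact Subalgebra.smul_mem _ hx c
  let θ : AddMonoidAlgebra R (Fin d → ℤ) →ₐ[R] AddMonoidAlgebra R (fixedExponents φ) :=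
    (AlgEquiv.ofInjective (ι.comp ρ) (hι.comp hρ)).symm.toAlgHom.comp
      ((φ.comp ι).codRestrict _ hmem)
  have hθ : ∀ x, φ (ι x) = ι (ρ (θ x)) := fun x =>
    (congrArg Subtype.val ((AlgEquiv.ofInjective (ι.comp ρ) (hι.comp hρ)).apply_symm_apply
      ⟨φ (ι x), hmem x⟩)).symm
  obtain ⟨s, hs, ⟨ε⟩⟩ := exists_range_algEquiv_mvPolynomial κ φ hφ ρ hρ θ
    (fun l => DFunLike.congr_fun hφρ l) hθ
  exact ⟨s, hs, ⟨ε.trans (mvPolynomialAlgEquivMixedLaurent R s e)⟩⟩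
end
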